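/- Let ν = 2 (so n = 4·m_2 with m_2 odd and m_1 = 2·m_2), let a ∈ F_{2^{m_1}}^* with K_{m_1}(a) ≡ 1 (mod 3), let b ∈ F_4^*, and let ω ∈ F_{2^{m_1}}^* ⊆ F_{2^n}^* have polar decomposition ω = w_2·y in F_{2^{m_1}}^* with w_2 ∈ U_2 and y ∈ F_{2^{m_2}}^*; set γ = b·χ_{m_1}(w_2) and let t ∈ {0,1} represent tr_2(γ) ∈ F_2. Then 3·S_2(a,b,ω) = 2^{m_2+1} − K_{m_1}(a) − 3·t·2^{m_2}, and the Walsh transform satisfies 3·(W_{f_{a,b}}(ω) − (−1)^t·2^{m_1}) = 4 − K_{m_1}(a). -/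

import Mathlib

open Finset

attribute [local instance] Classical.propDecidable

noncomputable section

/-- The absolute trace `Tr^k` of `GF(2^k)`, as a function on an ambient field of
characteristic two containing `GF(2^k)`. -/
def absTr {F : Type*} [Field F] (k : ℕ) (x : F) : F :=
  ∑ i ∈ Finset.range k, x ^ 2 ^ i

/-- The relative field trace `Tr^k_j` from `GF(2^k)` to `GF(2^j)`. -/
def relTr {F : Type*} [Field F] (k j : ℕ) (x : F) : F :=
  ∑ i ∈ Finset.range (k / j), x ^ 2 ^ (j * i)

/-- `(-1)^b` for `b ∈ F_2`, viewed inside an ambient field of characteristic two. -/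
def sgn {F : Type*} [Field F] (b : F) : ℤ := if b = 0 then 1 else -1

/-- The subfield `GF(2^k)` of the ambient field, as a finset. -/
def gf (F : Type*) [Field F] [Fintype F] (k : ℕ) : Finset F :=
  Finset.univ.filter fun x => x ^ 2 ^ k = x

/-- The trace of `F_4` down to `F_2`, `tr_2(y) = y + y²`. -/
def tr2 {F : Type*} [Field F] (y : F) : F := y + y ^ 2

/-- The cubic multiplicative character `χ_k(x) = x^((2^k-1)/3)` of `GF(2^k)`. -/
def chi {F : Type*} [Field F] (k : ℕ) (x : F) : F := x ^ ((2 ^ k - 1) / 3)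

/-- The Walsh transform at `ω` of a Boolean function on `GF(2^n)`
(with values in `F_2` inside the ambient field). -/
def walsh {F : Type*} [Field F] [Fintype F] (n : ℕ) (f : F → F) (ω : F) : ℤ :=
  ∑ x : F, sgn (f x + absTr n (ω * x))

/-- The binary Kloosterman sum `K_k(a)` (with the convention `0⁻¹ = 0`). -/
def kloo {F : Type*} [Field F] [Fintype F] (k : ℕ) (a : F) : ℤ :=
  ∑ x ∈ gf F k, sgn (absTr k (a * x + x⁻¹))

/-- The binary cubic sum `C_k(a,b)`. -/
def cub {F : Type*} [Field F] [Fintype F] (k : ℕ) (a b : F) : ℤ :=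
  ∑ x ∈ gf F k, sgn (absTr k (a * x ^ 3 + b * x))

/-- `f_a(x) = Tr^n(a · x^(2^{m₁}-1))`. -/
def fA {F : Type*} [Field F] (n m1 : ℕ) (a x : F) : F :=
  absTr n (a * x ^ (2 ^ m1 - 1))

/-- `g_b(x) = tr_2(b · χ_n(x))`. -/
def gB {F : Type*} [Field F] (n : ℕ) (b x : F) : F := tr2 (b * chi n x)

/-- The binomial Boolean function `f_{a,b} = f_a + g_b`. -/
def fAB {F : Type*} [Field F] (n m1 : ℕ) (a b x : F) : F :=
  fA n m1 a x + gB n b x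

/-- `U`, the image of `U_1 × ⋯ × U_ν` in `GF(2^n)^*` under multiplication, where
`U_i` is the subgroup of `(2^{m_i}+1)`-th roots of unity and `m_i = 2^{ν-i}·m`. -/
def bigU (F : Type*) [Field F] [Fintype F] (ν m : ℕ) : Finset F :=
  Finset.univ.filter fun u => ∃ c : Fin ν → F,
    (∀ i : Fin ν, c i ^ (2 ^ (2 ^ (ν - 1 - (i : ℕ)) * m) + 1) = 1) ∧ u = ∏ i, c i

/-- For `ν = 2`, the sum `S_2(a, b, ω) = ∑ (−1)^{f_a(u₁)}`, ranging over pairs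
`(u₁, u₂) ∈ U_1 × U_2` such that, with `u = u₁·u₂`, `Tr^n_{m₁}(u·ω) ≠ 0`,
`Tr^n_{m₂}(u·ω) = 0` and `b·χ_n(u₂) = 1`. -/
def S2 {F : Type*} [Field F] [Fintype F] (n m1 m2 : ℕ) (a b ω : F) : ℤ :=
  ∑ p ∈ Finset.univ.filter (fun p : F × F =>
      p.1 ^ (2 ^ m1 + 1) = 1 ∧ p.2 ^ (2 ^ m2 + 1) = 1 ∧
      relTr n m1 (p.1 * p.2 * ω) ≠ 0 ∧
      relTr n m2 (p.1 * p.2 * ω) = 0 ∧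
      b * chi n p.2 = 1),
    sgn (fA n m1 a p.1)

section BinaryField

variable {L : Type*} [Field L]

/-- The canonical additive character `(-1)^{Tr^k(x)}`, with integer values. -/
def psi (k : ℕ) (x : L) : ℤ := sgn (absTr k x)

lemma psi_eq_one_or (k : ℕ) (x : L) : psi k x = 1 ∨ psi k x = -1 := by
  unfold psi sgn
  split_ifs <;> simp

@[simp] lemma absTr_zero (k : ℕ) : absTr k (0 : L) = 0 := by
  simp [absTr]

@[simp] lemma psi_zero (k : ℕ) : psi k (0 : L) = 1 := by
  simp [psi, sgn]

lemma pow_two_pow_card [Fintype L] {k : ℕ} (hL : Fintype.card L = 2 ^ k) (x : L) :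
    x ^ 2 ^ k = x := by
  rw [← hL, FiniteField.pow_card]

lemma exists_absTr_ne_zero [Fintype L] {k : ℕ} (hL : Fintype.card L = 2 ^ k) (hk : k ≠ 0) :
    ∃ x : L, absTr k x ≠ 0 := by
  by_contra! hall
  let p : Polynomial L := ∑ i ∈ Finset.range k, Polynomial.X ^ 2 ^ i
  have hdeg : p.natDegree < Fintype.card L := by
    rw [hL]
    refine lt_of_le_of_lt (Polynomial.natDegree_sum_le_of_forall_le (n := 2 ^ (k - 1)) _ _ ?_)
      (Nat.pow_lt_pow_right (by norm_num) (by omega))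
    intro i hi
    rw [Polynomial.natDegree_X_pow]
    exact Nat.pow_le_pow_right (by norm_num) (by have := Finset.mem_range.1 hi; omega)
  have hp : p = 0 := by
    refine Polynomial.eq_zero_of_natDegree_lt_card_of_eval_eq_zero p Function.injective_id
      (fun x => ?_) hdeg
    simpa [p, absTr, Polynomial.eval_finsetSum] using hall x
  have hc : p.coeff 1 = 1 := by
    simp only [p, Polynomial.finsetSum_coeff, Polynomial.coeff_X_pow]
    rw [Finset.sum_eq_single 0]
    · simp
    · intro i _ hi
      rw [if_neg]
      exact (Nat.one_lt_two_pow hi).ne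
    · intro h
      exact absurd (Finset.mem_range.2 (Nat.pos_of_ne_zero hk)) h
  rw [hp] at hc
  simp at hc

variable [CharP L 2]

lemma absTr_add (k : ℕ) (x y : L) : absTr k (x + y) = absTr k x + absTr k y := by
  simp [absTr, add_pow_char_pow, Finset.sum_add_distrib]

lemma absTr_sq (k : ℕ) (x : L) : absTr k (x ^ 2) = absTr k x ^ 2 := by
  unfold absTr
  rw [sum_pow_char]
  exact Finset.sum_congr rfl fun i _ => by rw [← pow_mul, ← pow_mul, mul_comm]

lemma sgn_add {b c : L} (hb : b ^ 2 = b) (hc : c ^ 2 = c) : sgn (b + c) = sgn b * sgn c := by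
  have key : ∀ x : L, x ^ 2 = x → x = 0 ∨ x = 1 := fun x hx => by
    have : x * (x - 1) = 0 := by linear_combination hx
    rcases mul_eq_zero.1 this with h | h
    · exact Or.inl h
    · exact Or.inr (sub_eq_zero.1 h)
  rcases key b hb with rfl | rfl <;> rcases key c hc with rfl | rfl <;>
    simp [sgn, CharTwo.add_self_eq_zero]

lemma psi_one_of_even {k : ℕ} (hk : Even k) : psi k (1 : L) = 1 := by
  obtain ⟨j, rfl⟩ := hk
  simp [psi, sgn, absTr, CharTwo.add_self_eq_zero]

variable [Fintype L] {k : ℕ}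

lemma absTr_pow_two (hL : Fintype.card L = 2 ^ k) (x : L) : absTr k x ^ 2 = absTr k x := by
  unfold absTr
  rw [sum_pow_char]
  have h1 := Finset.sum_range_succ' (fun i => x ^ 2 ^ i) k
  rw [Finset.sum_range_succ, pow_two_pow_card hL] at h1
  simp only [pow_zero, pow_one, add_left_inj] at h1
  rw [h1]
  exact Finset.sum_congr rfl fun i _ => by rw [← pow_mul, pow_succ]

lemma psi_add (hL : Fintype.card L = 2 ^ k) (x y : L) :
    psi k (x + y) = psi k x * psi k y := by
  unfold psi
  rw [absTr_add, sgn_add (absTr_pow_two hL x) (absTr_pow_two hL y)]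

lemma psi_sq (hL : Fintype.card L = 2 ^ k) (x : L) : psi k (x ^ 2) = psi k x := by
  unfold psi
  rw [absTr_sq, absTr_pow_two hL]

lemma sq_bijective : Function.Bijective (fun x : L => x ^ 2) :=
  Finite.injective_iff_bijective.1 (frobenius_inj L 2)

lemma sum_sq_eq {M : Type*} [AddCommMonoid M] (h : L → M) : ∑ x, h (x ^ 2) = ∑ x, h x :=
  Fintype.sum_bijective _ sq_bijective _ _ fun _ => rfl

lemma sum_psi (hL : Fintype.card L = 2 ^ k) (hk : k ≠ 0) : ∑ x : L, psi k x = 0 := by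
  obtain ⟨x₀, hx₀⟩ := exists_absTr_ne_zero hL hk
  have h := Equiv.sum_comp (Equiv.addRight x₀) (fun x : L => psi k x)
  simp only [Equiv.coe_addRight, psi_add hL, ← Finset.sum_mul] at h
  have : psi k x₀ = -1 := by simp [psi, sgn, hx₀]
  rw [this] at h
  linarith

lemma sum_psi_mul [DecidableEq L] (hL : Fintype.card L = 2 ^ k) (hk : k ≠ 0) (c : L) :
    ∑ x : L, psi k (c * x) = if c = 0 then 2 ^ k else 0 := by
  split_ifs with hc
  · simp [hc, hL]
  · rw [← sum_psi hL hk]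
    exact Equiv.sum_comp (Equiv.mulLeft₀ c hc) (fun x : L => psi k x)

lemma card_artin_schreier [DecidableEq L] (hL : Fintype.card L = 2 ^ k) (hk : k ≠ 0) (c : L) :
    (#{w : L | w ^ 2 + w = c} : ℤ) = 1 + psi k c := by
  have h2 : (2 : ℤ) ^ k ≠ 0 := by positivity
  apply mul_left_cancel₀ h2
  have h1 : ∑ w : L, ∑ t : L, psi k ((w ^ 2 + w + c) * t) =
      2 ^ k * (#{w : L | w ^ 2 + w = c} : ℤ) := by
    simp_rw [sum_psi_mul hL hk, CharTwo.add_eq_zero]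
    rw [← Finset.sum_filter, Finset.sum_const, nsmul_eq_mul, mul_comm]
  rw [← h1, Finset.sum_comm]
  have h3 : ∀ t : L, ∑ w : L, psi k ((w ^ 2 + w + c) * t) =
      if t ^ 2 + t = 0 then 2 ^ k * psi k (c * t) else 0 := fun t => by
    have : ∀ w : L, psi k ((w ^ 2 + w + c) * t) = psi k ((t ^ 2 + t) * w ^ 2) * psi k (c * t) :=
      fun w => by
        rw [show (w ^ 2 + w + c) * t = w ^ 2 * t + (w * t + c * t) by ring, psi_add hL,
          psi_add hL, ← psi_sq hL (w * t),
          show (t ^ 2 + t) * w ^ 2 = w ^ 2 * t + (w * t) ^ 2 by ring, psi_add hL, mul_assoc]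
    simp_rw [this]
    rw [← Finset.sum_mul, sum_sq_eq (fun x => psi k ((t ^ 2 + t) * x)), sum_psi_mul hL hk]
    split_ifs <;> simp
  simp_rw [h3]
  rw [← Finset.sum_filter]
  have h4 : Finset.univ.filter (fun t : L => t ^ 2 + t = 0) = {0, 1} := by
    ext t
    simp only [Finset.mem_filter, Finset.mem_univ, true_and, Finset.mem_insert,
      Finset.mem_singleton]
    rw [show t ^ 2 + t = t * (t + 1) by ring, mul_eq_zero, CharTwo.add_eq_zero]
  rw [h4, Finset.sum_pair zero_ne_one]
  simp
  ring

lemma card_add_inv_eq [DecidableEq L] (hL : Fintype.card L = 2 ^ k) (hk : k ≠ 0) {s : L}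
    (hs : s ≠ 0) :
    (#{z : L | z ≠ 0 ∧ z + z⁻¹ = s} : ℤ) = 1 + psi k s⁻¹ := by
  rw [← psi_sq hL, ← card_artin_schreier hL hk]
  congr 1
  symm
  refine Finset.card_bij' (fun w _ => s * w) (fun z _ => s⁻¹ * z) ?_ ?_ ?_ ?_
  · intro w hw
    have hw : w ^ 2 + w = s⁻¹ ^ 2 := by simpa using hw
    have hw0 : w ≠ 0 := by
      rintro rfl
      exact hs (by simpa using hw.symm)
    have h1 : (s * w) ^ 2 + 1 = s * (s * w) := by
      have : s ^ 2 * (w ^ 2 + w) = 1 := by rw [hw]; field_simp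
      linear_combination this + s * (s * w) * (CharTwo.two_eq_zero (R := L)) * 0 -
        (s ^ 2 * w) * (CharTwo.two_eq_zero (R := L)) + CharTwo.two_eq_zero (R := L)
    have h0 : s * w ≠ 0 := mul_ne_zero hs hw0
    simp only [Finset.mem_filter, Finset.mem_univ, true_and]
    refine ⟨h0, ?_⟩
    apply mul_right_cancel₀ h0
    rw [add_mul, inv_mul_cancel₀ h0]
    linear_combination h1
  · intro z hz
    obtain ⟨hz0, hz⟩ : z ≠ 0 ∧ z + z⁻¹ = s := by simpa using hz
    have h1 : z ^ 2 + 1 = s * z := by rw [← hz]; field_simp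
    simp only [Finset.mem_filter, Finset.mem_univ, true_and]
    field_simp
    linear_combination h1 + (z * s - 1) * (CharTwo.two_eq_zero (R := L))
  · intro w _
    field_simp
  · intro z _
    field_simp

lemma sum_add_inv [DecidableEq L] (hL : Fintype.card L = 2 ^ k) (hk : k ≠ 0) (g : L → ℤ) :
    ∑ z : L with z ≠ 0, g (z + z⁻¹) + g 0 = ∑ s : L, (1 + psi k s⁻¹) * g s := by
  have h : ∀ s : L, ((#{z : L | z ≠ 0 ∧ z + z⁻¹ = s} : ℤ)) * g s +
      (if s = 0 then g 0 else 0) = (1 + psi k s⁻¹) * g s := fun s => by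
    split_ifs with hs
    · subst hs
      have : Finset.univ.filter (fun z : L => z ≠ 0 ∧ z + z⁻¹ = 0) = {1} := by
        ext z
        simp only [Finset.mem_filter, Finset.mem_univ, true_and, Finset.mem_singleton]
        constructor
        · rintro ⟨h0, h⟩
          have h1 : z = z⁻¹ := CharTwo.add_eq_zero.1 h
          have h2 : z ^ 2 = 1 ^ 2 := by
            nth_rw 1 [pow_two, h1, inv_mul_cancel₀ h0, one_pow]
          exact sq_bijective.injective h2
        · rintro rfl
          simp [CharTwo.add_self_eq_zero]
      rw [this]
      simp
      ring
    · rw [card_add_inv_eq hL hk hs, add_zero]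
  simp_rw [← h]
  rw [Finset.sum_add_distrib, Finset.sum_ite_eq' Finset.univ (0 : L)]
  simp only [Finset.mem_univ, if_true, add_left_inj]
  rw [← Finset.sum_fiberwise (s := Finset.univ.filter fun z : L => z ≠ 0)
    (g := fun z => z + z⁻¹)]
  refine Finset.sum_congr rfl fun s _ => ?_
  rw [← Finset.filter_filter, ← nsmul_eq_mul, ← Finset.sum_const]
  refine Finset.sum_congr rfl fun z hz => ?_
  rw [(Finset.mem_filter.1 hz).2]

lemma sq_sum_psi_cubic [DecidableEq L] (hL : Fintype.card L = 2 ^ k) (hk : k ≠ 0) (e b : L) :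
    (∑ x : L, psi k (e * x ^ 3 + b * x)) ^ 2 =
      2 ^ k * ∑ y : L with e * y + e ^ 2 * y ^ 4 = 0, psi k (e * y ^ 3 + b * y) := by
  have h1 : ∀ x : L, ∑ y : L, psi k (e * y ^ 3 + b * y) =
      ∑ y : L, psi k (e * (y + x) ^ 3 + b * (y + x)) := fun x =>
    (Equiv.sum_comp (Equiv.addRight x) (fun y : L => psi k (e * y ^ 3 + b * y))).symm
  have h2 : ∀ x y : L, psi k (e * x ^ 3 + b * x) * psi k (e * (y + x) ^ 3 + b * (y + x)) =
      psi k (e * y ^ 3 + b * y) * psi k ((e * y + e ^ 2 * y ^ 4) * x ^ 2) := fun x y => by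
    rw [show (e * y + e ^ 2 * y ^ 4) * x ^ 2 = e * y * x ^ 2 + (e * x * y ^ 2) ^ 2 by ring,
      psi_add hL (e * y * x ^ 2), psi_sq hL, ← psi_add hL, ← psi_add hL, ← psi_add hL]
    congr 1
    linear_combination (e * x ^ 3 + b * x + e * x * y ^ 2 + e * x ^ 2 * y) *
      (CharTwo.two_eq_zero (R := L))
  rw [pow_two, Finset.sum_mul]
  simp_rw [Finset.mul_sum]
  calc _ = ∑ x : L, ∑ y : L, psi k (e * x ^ 3 + b * x) *
        psi k (e * (y + x) ^ 3 + b * (y + x)) := by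
        refine Finset.sum_congr rfl fun x _ => ?_
        rw [← Finset.mul_sum, h1 x, Finset.mul_sum]
    _ = _ := by
        simp_rw [h2]
        rw [Finset.sum_comm, Finset.sum_filter]
        refine Finset.sum_congr rfl fun y _ => ?_
        rw [← Finset.mul_sum, sum_sq_eq (fun x => psi k ((e * y + e ^ 2 * y ^ 4) * x)),
          sum_psi_mul hL hk]
        split_ifs <;> ring

end BinaryField

section CubicCharacter

lemma three_mul_two_pow_sub_one_div {k : ℕ} (hk : Even k) :
    3 * ((2 ^ k - 1) / 3) = 2 ^ k - 1 := by
  obtain ⟨j, rfl⟩ := hk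
  apply Nat.mul_div_cancel'
  rw [← two_mul, pow_mul]
  simpa using Nat.sub_dvd_pow_sub_pow 4 1 j

lemma two_pow_sub_one_div_pos {k : ℕ} (hk : Even k) (hk0 : k ≠ 0) : 0 < (2 ^ k - 1) / 3 := by
  have h := three_mul_two_pow_sub_one_div hk
  have := Nat.one_lt_two_pow hk0
  omega

variable {L : Type*} [Field L]

lemma chi_mul (k : ℕ) (x y : L) : chi k (x * y) = chi k x * chi k y := mul_pow _ _ _

lemma chi_inv (k : ℕ) (x : L) : chi k x⁻¹ = (chi k x)⁻¹ := inv_pow _ _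

lemma chi_zero {k : ℕ} (hk : Even k) (hk0 : k ≠ 0) : chi k (0 : L) = 0 :=
  zero_pow (two_pow_sub_one_div_pos hk hk0).ne'

lemma ne_zero_of_chi {k : ℕ} (hk : Even k) (hk0 : k ≠ 0) {x c : L} (hc : c ^ 3 = 1)
    (h : chi k x = c) : x ≠ 0 := by
  rintro rfl
  rw [chi_zero hk hk0] at h
  rw [← h] at hc
  simp at hc

lemma cube_root_unity_cases {c x : L} (hc : c ^ 3 = 1) (hc1 : c ≠ 1) (hx : x ^ 3 = 1) :
    x = 1 ∨ x = c ∨ x = c ^ 2 := by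
  have h0 : c ^ 2 + c + 1 = 0 := by
    apply mul_left_cancel₀ (sub_ne_zero.2 hc1)
    linear_combination hc
  have : (x - 1) * ((x - c) * (x - c ^ 2)) = 0 := by
    linear_combination hx - hc + (-x ^ 2 + c * x) * h0
  rcases mul_eq_zero.1 this with h | h
  · exact Or.inl (sub_eq_zero.1 h)
  · rcases mul_eq_zero.1 h with h | h
    · exact Or.inr (Or.inl (sub_eq_zero.1 h))
    · exact Or.inr (Or.inr (sub_eq_zero.1 h))

variable [Fintype L] {k : ℕ}

lemma chi_pow_three (hL : Fintype.card L = 2 ^ k) (hk : Even k) {x : L} (hx : x ≠ 0) :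
    chi k x ^ 3 = 1 := by
  rw [chi, ← pow_mul, mul_comm, three_mul_two_pow_sub_one_div hk, ← hL,
    FiniteField.pow_card_sub_one_eq_one x hx]

lemma exists_primitive_element (hL : Fintype.card L = 2 ^ k) :
    ∃ g : L, g ≠ 0 ∧ (∀ v : L, v ≠ 0 → ∃ j : ℕ, v = g ^ j) ∧
      ∀ j : ℕ, g ^ j = 1 ↔ 2 ^ k - 1 ∣ j := by
  obtain ⟨g, hg⟩ := IsCyclic.exists_generator (α := Lˣ)
  refine ⟨g, g.ne_zero, fun v hv => ?_, fun j => ?_⟩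
  · obtain ⟨j, hj⟩ := (Submonoid.mem_powers_iff _ _).1
      (mem_powers_iff_mem_zpowers.2 (hg (Units.mk0 v hv)))
    exact ⟨j, by rw [← Units.val_pow_eq_pow_val, hj, Units.val_mk0]⟩
  · rw [← hL, ← Fintype.card_units, ← Nat.card_eq_fintype_card,
      ← orderOf_eq_card_of_forall_mem_zpowers hg, orderOf_dvd_iff_pow_eq_one,
      ← Units.val_pow_eq_pow_val, Units.val_eq_one]

lemma exists_cube_root (hL : Fintype.card L = 2 ^ k) (hk : Even k) (hk0 : k ≠ 0) {v : L}
    (hv : chi k v = 1) : ∃ z : L, z ^ 3 = v := by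
  obtain ⟨g, -, hgen, hord⟩ := exists_primitive_element hL
  obtain ⟨j, rfl⟩ := hgen v (ne_zero_of_chi hk hk0 (one_pow 3) hv)
  rw [chi, ← pow_mul, hord] at hv
  have hdvd : 3 * ((2 ^ k - 1) / 3) ∣ j * ((2 ^ k - 1) / 3) := by
    rwa [three_mul_two_pow_sub_one_div hk]
  obtain ⟨i, rfl⟩ := Nat.dvd_of_mul_dvd_mul_right (two_pow_sub_one_div_pos hk hk0) hdvd
  exact ⟨g ^ i, by rw [← pow_mul, mul_comm]⟩

lemma chi_cube (hL : Fintype.card L = 2 ^ k) (hk : Even k) {z : L} (hz : z ≠ 0) :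
    chi k (z ^ 3) = 1 := by
  rw [← chi_pow_three hL hk hz, chi, chi, ← pow_mul, ← pow_mul, mul_comm]

lemma exists_chi_eq (hL : Fintype.card L = 2 ^ k) (hk : Even k) {c : L}
    (hc : c ^ 3 = 1) : ∃ v : L, v ≠ 0 ∧ chi k v = c := by
  obtain ⟨g, hg0, hgen, hord⟩ := exists_primitive_element hL
  have hc0 : c ≠ 0 := by
    rintro rfl
    simp at hc
  obtain ⟨j, rfl⟩ := hgen c hc0
  rw [← pow_mul, hord, ← three_mul_two_pow_sub_one_div hk, mul_comm] at hc
  obtain ⟨i, rfl⟩ := Nat.dvd_of_mul_dvd_mul_right (by norm_num) hc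
  exact ⟨g ^ i, pow_ne_zero _ hg0, by rw [chi, ← pow_mul, mul_comm]⟩

lemma exists_primitive_cube_root (hL : Fintype.card L = 2 ^ k) (hk : Even k) (hk0 : k ≠ 0) :
    ∃ ζ : L, ζ ^ 3 = 1 ∧ ζ ≠ 1 := by
  obtain ⟨g, hg0, -, hord⟩ := exists_primitive_element hL
  have h := three_mul_two_pow_sub_one_div hk
  have hpos := two_pow_sub_one_div_pos hk hk0
  refine ⟨g ^ ((2 ^ k - 1) / 3), chi_pow_three hL hk hg0, fun h1 => ?_⟩
  have := Nat.le_of_dvd hpos ((hord _).1 h1)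
  omega

lemma filter_cube_eq_one [DecidableEq L] {ζ : L} (hζ : ζ ^ 3 = 1) (hζ1 : ζ ≠ 1) :
    Finset.univ.filter (fun x : L => x ^ 3 = 1) = {1, ζ, ζ ^ 2} := by
  ext x
  simp only [Finset.mem_filter, Finset.mem_univ, true_and, Finset.mem_insert,
    Finset.mem_singleton]
  refine ⟨cube_root_unity_cases hζ hζ1, ?_⟩
  rintro (rfl | rfl | rfl)
  · simp
  · exact hζ
  · rw [← pow_mul, mul_comm, pow_mul, hζ, one_pow]

lemma sum_cube_roots_unity [DecidableEq L] {M : Type*} [AddCommMonoid M] {ζ : L} (hζ : ζ ^ 3 = 1)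
    (hζ1 : ζ ≠ 1)
    (h : L → M) : ∑ x : L with x ^ 3 = 1, h x = h 1 + (h ζ + h (ζ ^ 2)) := by
  have hζ0 : ζ ≠ 0 := by
    rintro rfl
    simp at hζ
  have h2 : ζ ^ 2 ≠ 1 := fun h => hζ1 (by rw [pow_succ, h, one_mul] at hζ; exact hζ)
  have h3 : ζ ≠ ζ ^ 2 := fun h => hζ1 (by
    apply mul_left_cancel₀ hζ0
    rw [← pow_two, ← h, mul_one])
  rw [filter_cube_eq_one hζ hζ1, Finset.sum_insert, Finset.sum_pair h3]
  simp [hζ1.symm, h2.symm]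

lemma sum_cubes [DecidableEq L] (hL : Fintype.card L = 2 ^ k) (hk : Even k) (hk0 : k ≠ 0)
    (h : L → ℤ) :
    ∑ z : L with z ≠ 0, h (z ^ 3) = 3 * ∑ v : L with chi k v = 1, h v := by
  obtain ⟨ζ, hζ, hζ1⟩ := exists_primitive_cube_root hL hk hk0
  rw [← Finset.sum_fiberwise_of_maps_to (s := Finset.univ.filter fun z : L => z ≠ 0)
    (t := Finset.univ.filter fun v : L => chi k v = 1) (g := fun z => z ^ 3)
    (fun z hz => by simpa using chi_cube hL hk (by simpa using hz)), Finset.mul_sum]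
  refine Finset.sum_congr rfl fun v hv => ?_
  have hv1 : chi k v = 1 := by simpa using hv
  have hv0 := ne_zero_of_chi hk hk0 (one_pow 3) hv1
  obtain ⟨z, rfl⟩ := exists_cube_root hL hk hk0 hv1
  have hz : z ≠ 0 := by
    rintro rfl
    simp at hv0
  have h1 : ∀ x ∈ (Finset.univ.filter fun z : L => z ≠ 0).filter (fun x => x ^ 3 = z ^ 3),
      h (x ^ 3) = h (z ^ 3) := fun x hx => by rw [(Finset.mem_filter.1 hx).2]
  rw [Finset.sum_congr rfl h1, Finset.sum_const, nsmul_eq_mul]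
  congr 1
  have h2 : #(Finset.univ.filter fun x : L => x ^ 3 = 1) = 3 := by
    rw [Finset.card_eq_sum_ones, sum_cube_roots_unity hζ hζ1]
    norm_num
  refine Eq.trans (congrArg Nat.cast (Eq.trans ?_ h2)) (Nat.cast_ofNat)
  refine Finset.card_bij' (fun x _ => x / z) (fun x _ => x * z) ?_ ?_ ?_ ?_
  · intro x hx
    have hx : x ^ 3 = z ^ 3 := (Finset.mem_filter.1 hx).2
    simp [div_pow, hx, hz]
  · intro x hx
    have hx : x ^ 3 = 1 := by simpa using hx
    have hx0 : x ≠ 0 := by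
      rintro rfl
      simp at hx
    simp [mul_pow, hx, hx0, hz]
  · intro x _
    field_simp
  · intro x _
    field_simp

lemma sum_chi_eq [DecidableEq L] (hk : Even k) (hk0 : k ≠ 0) {g c : L} (hc : c ^ 3 = 1)
    (hg : chi k g = c)
    (h : L → ℤ) : ∑ v : L with chi k v = c, h v = ∑ v : L with chi k v = 1, h (g * v) := by
  have hg0 : g ≠ 0 := ne_zero_of_chi hk hk0 hc hg
  have hc0 : c ≠ 0 := by
    rintro rfl
    simp at hc
  rw [Finset.sum_filter, Finset.sum_filter, ← Equiv.sum_comp (Equiv.mulLeft₀ g hg0)]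
  refine Finset.sum_congr rfl fun v _ => ?_
  simp [chi_mul, hg, hc0]

/-- The values of `h` over the nonzero elements split along the three classes of `χ`. -/
lemma sum_chi_classes [DecidableEq L] (hL : Fintype.card L = 2 ^ k) (hk : Even k) (hk0 : k ≠ 0)
    {c : L}
    (hc : c ^ 3 = 1) (hc1 : c ≠ 1) (h : L → ℤ) :
    ∑ v : L with v ≠ 0, h v = ∑ v : L with chi k v = 1, h v +
      (∑ v : L with chi k v = c, h v + ∑ v : L with chi k v = c ^ 2, h v) := by
  rw [← sum_cube_roots_unity hc hc1 (fun d => ∑ v : L with chi k v = d, h v),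
    ← Finset.sum_fiberwise_of_maps_to (s := Finset.univ.filter fun z : L => z ≠ 0)
    (t := Finset.univ.filter fun d : L => d ^ 3 = 1) (g := chi k)
    (fun z hz => by simpa using chi_pow_three hL hk (by simpa using hz))]
  refine Finset.sum_congr rfl fun d hd => ?_
  have hd : d ^ 3 = 1 := by simpa using hd
  rw [Finset.filter_filter]
  refine Finset.sum_congr (Finset.filter_congr fun v _ => ?_) fun _ _ => rfl
  exact ⟨fun h => h.2, fun h => ⟨ne_zero_of_chi hk hk0 hd h, h⟩⟩

lemma card_chi_eq [DecidableEq L] (hL : Fintype.card L = 2 ^ k) (hk : Even k) (hk0 : k ≠ 0) {c : L}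
    (hc : c ^ 3 = 1) : 3 * (#{v : L | chi k v = c} : ℤ) = 2 ^ k - 1 := by
  obtain ⟨g, -, hg⟩ := exists_chi_eq hL hk hc
  have h1 := sum_chi_eq hk hk0 hc hg (fun _ => 1)
  have h2 := sum_cubes hL hk hk0 (fun _ => 1)
  have h3 : (Finset.univ.filter fun z : L => z ≠ 0) = Finset.univ.erase 0 := by
    ext; simp
  simp only [Finset.sum_const, nsmul_eq_mul, mul_one] at h1 h2
  rw [h1, ← h2, h3, Finset.card_erase_of_mem (Finset.mem_univ _), Finset.card_univ, hL,
    Nat.cast_sub Nat.one_le_two_pow]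
  simp

end CubicCharacter

section CubicSums

lemma three_dvd_four_pow_sub_one (j : ℕ) : (3 : ℤ) ∣ 4 ^ j - 1 := by
  simpa using sub_dvd_pow_sub_pow (4 : ℤ) 1 j

variable {L : Type*} [Field L] [Fintype L] {k : ℕ}

lemma sum_eq_zero_add_sum_ne_zero [DecidableEq L] (h : L → ℤ) :
    ∑ x, h x = h 0 + ∑ x : L with x ≠ 0, h x := by
  have : (Finset.univ.filter fun z : L => z ≠ 0) = Finset.univ.erase 0 := by
    ext; simp
  rw [this, Finset.add_sum_erase _ _ (Finset.mem_univ _)]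

lemma sum_psi_chi_inv [DecidableEq L] (hL : Fintype.card L = 2 ^ k) (hke : Even k) (hk0 : k ≠ 0)
    {d : L}
    {K : ℤ} (hC : ∑ z : L with z ≠ 0, psi k (d * (z ^ 3 + (z ^ 3)⁻¹)) = K - 1)
    (hK : ∑ x : L, psi k (d * (x + x⁻¹)) = K) {c : L} (hc : c ^ 3 = 1) :
    3 * ∑ v : L with chi k v = c, psi k (d * (v + v⁻¹)) = K - 1 := by
  rw [sum_cubes hL hke hk0 (fun z => psi k (d * (z + z⁻¹)))] at hC
  by_cases hc1 : c = 1
  · rw [hc1, hC]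
  · have h2 := sum_chi_classes hL hke hk0 hc hc1 (fun z => psi k (d * (z + z⁻¹)))
    have h3 : ∑ v : L with chi k v = c ^ 2, psi k (d * (v + v⁻¹)) =
        ∑ v : L with chi k v = c, psi k (d * (v + v⁻¹)) := by
      rw [Finset.sum_filter, Finset.sum_filter, ← Equiv.sum_comp (Equiv.inv L)]
      refine Finset.sum_congr rfl fun v _ => ?_
      have hc0 : c ≠ 0 := by
        rintro rfl
        simp at hc
      have : c ^ 2 = c⁻¹ := by
        apply mul_right_cancel₀ hc0
        rw [← pow_succ, hc, inv_mul_cancel₀ hc0]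
      simp [chi_inv, this, add_comm]
    rw [sum_eq_zero_add_sum_ne_zero, h2, h3] at hK
    simp only [inv_zero, add_zero, mul_zero, psi_zero] at hK
    linarith

variable [CharP L 2]

lemma sum_psi_cube (hL : Fintype.card L = 2 ^ k) {m : ℕ} (hm : Odd m) (hk : k = 2 * m) :
    ∑ z : L, psi k (z ^ 3) = 2 ^ (m + 1) := by
  have hke : Even k := ⟨m, by omega⟩
  have hk0 : k ≠ 0 := by have := hm.pos; omega
  have hsq := sq_sum_psi_cubic hL hk0 (1 : L) 0
  simp only [one_mul, zero_mul, add_zero, one_pow] at hsq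
  have h1 : ∑ y : L with y + y ^ 4 = 0, psi k (y ^ 3) = 4 := by
    obtain ⟨ζ, hζ, hζ1⟩ := exists_primitive_cube_root hL hke hk0
    rw [Finset.sum_filter, sum_eq_zero_add_sum_ne_zero, ← Finset.sum_filter,
      Finset.filter_filter]
    have h2 : Finset.univ.filter (fun y : L => y ≠ 0 ∧ y + y ^ 4 = 0) =
        Finset.univ.filter (fun y : L => y ^ 3 = 1) := by
      ext y
      simp only [Finset.mem_filter, Finset.mem_univ, true_and]
      constructor
      · rintro ⟨h0, h⟩
        apply mul_left_cancel₀ h0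
        rw [CharTwo.add_eq_zero] at h
        linear_combination -h
      · intro h
        refine ⟨fun h0 => by simp [h0] at h, ?_⟩
        rw [CharTwo.add_eq_zero]
        linear_combination -y * h
    have h3 : ∀ y ∈ Finset.univ.filter (fun y : L => y ^ 3 = 1), psi k (y ^ 3) = 1 :=
      fun y hy => by rw [(Finset.mem_filter.1 hy).2, psi_one_of_even hke]
    rw [h2, Finset.sum_congr rfl h3, sum_cube_roots_unity hζ hζ1]
    simp
  rw [h1] at hsq
  have h4 : (2 : ℤ) ^ k * 4 = (2 ^ (m + 1)) ^ 2 := by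
    rw [hk]
    ring
  rw [h4] at hsq
  rcases sq_eq_sq_iff_eq_or_eq_neg.1 hsq with h | h
  · exact h
  · exfalso
    have h5 := sum_cubes hL hke hk0 (psi k)
    have h6 := sum_eq_zero_add_sum_ne_zero (fun z : L => psi k (z ^ 3))
    rw [h5, h] at h6
    obtain ⟨j, hj⟩ := hm
    have h7 := three_dvd_four_pow_sub_one (j + 1)
    have h8 : (2 : ℤ) ^ (m + 1) = 4 ^ (j + 1) := by
      rw [hj, show 2 * j + 1 + 1 = 2 * (j + 1) by ring, pow_mul]
      norm_num
    simp only [ne_eq, OfNat.ofNat_ne_zero, not_false_eq_true, zero_pow, psi_zero] at h6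
    omega

/-- The sum of `(-1)^{Tr(v)}` over a class of the cubic character. -/
lemma three_mul_sum_psi_chi [DecidableEq L] (hL : Fintype.card L = 2 ^ k) {m : ℕ} (hm : Odd m)
    (hk : k = 2 * m)
    {c : L} (hc : c ^ 3 = 1) :
    3 * ∑ v : L with chi k v = c, psi k v = if c = 1 then 2 ^ (m + 1) - 1 else -2 ^ m - 1 := by
  have hke : Even k := ⟨m, by omega⟩
  have hk0 : k ≠ 0 := by have := hm.pos; omega
  have h1 : 3 * ∑ v : L with chi k v = 1, psi k v = 2 ^ (m + 1) - 1 := by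
    rw [← sum_cubes hL hke hk0 (psi k), ← sum_psi_cube hL hm hk,
      sum_eq_zero_add_sum_ne_zero (fun z : L => psi k (z ^ 3))]
    simp
  split_ifs with hc1
  · rw [hc1, h1]
  · have h2 := sum_chi_classes hL hke hk0 hc hc1 (psi k)
    have h3 : ∑ v : L with chi k v = c ^ 2, psi k v = ∑ v : L with chi k v = c, psi k v := by
      rw [Finset.sum_filter, Finset.sum_filter, ← sum_sq_eq]
      refine Finset.sum_congr rfl fun v _ => ?_
      have : chi k (v ^ 2) = chi k v ^ 2 := by rw [pow_two, chi_mul, ← pow_two]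
      rw [psi_sq hL, this]
      exact if_congr sq_bijective.injective.eq_iff rfl rfl
    have h4 := sum_psi hL hk0
    rw [sum_eq_zero_add_sum_ne_zero, psi_zero, h2, h3] at h4
    rw [pow_succ] at h1
    linarith

lemma isCube_and_cubic_sum_eq_zero (hL : Fintype.card L = 2 ^ k) (hke : Even k) (hk0 : k ≠ 0)
    {d : L} (hd : d ≠ 0) (h3 : (3 : ℤ) ∣ ∑ x : L, psi k (d * x ^ 3 + d * x)) :
    chi k d = 1 ∧ ∑ x : L, psi k (d * x ^ 3 + d * x) = 0 := by
  have hsq := sq_sum_psi_cubic hL hk0 d d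
  generalize ∑ x : L, psi k (d * x ^ 3 + d * x) = S at h3 hsq ⊢
  have hprime : Prime (3 : ℤ) := Int.prime_three
  have hpow : ¬ (3 : ℤ) ∣ 2 ^ k := fun h => by
    have := hprime.dvd_of_dvd_pow h
    norm_num at this
  have hdvd := dvd_pow h3 two_ne_zero
  rw [hsq] at hdvd
  have hdvd := (hprime.dvd_or_dvd hdvd).resolve_left hpow
  rw [Finset.sum_filter, sum_eq_zero_add_sum_ne_zero, ← Finset.sum_filter,
    Finset.filter_filter] at hdvd hsq
  have hset : ∀ y : L, (y ≠ 0 ∧ d * y + d ^ 2 * y ^ 4 = 0) ↔ d * y ^ 3 = 1 := fun y => by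
    constructor
    · rintro ⟨h0, h⟩
      apply mul_left_cancel₀ (mul_ne_zero hd h0)
      rw [CharTwo.add_eq_zero] at h
      linear_combination -h
    · intro h
      refine ⟨fun h0 => by simp [h0] at h, ?_⟩
      rw [CharTwo.add_eq_zero]
      linear_combination -(d * y) * h
  simp only [hset, mul_zero, ne_eq, OfNat.ofNat_ne_zero, not_false_eq_true, zero_pow, add_zero,
    psi_zero, if_true] at hdvd hsq
  have hchi : chi k d = 1 := by
    by_contra hchi
    have : Finset.univ.filter (fun y : L => d * y ^ 3 = 1) = ∅ := by
      refine Finset.filter_eq_empty_iff.2 fun y _ h => hchi ?_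
      have hy : y ≠ 0 := fun h0 => by simp [h0] at h
      rw [eq_inv_of_mul_eq_one_left h, chi_inv, chi_cube hL hke hy, inv_one]
    rw [this] at hdvd
    norm_num at hdvd
  refine ⟨hchi, ?_⟩
  obtain ⟨δ, rfl⟩ := exists_cube_root hL hke hk0 hchi
  have hδ : δ ≠ 0 := fun h0 => by simp [h0] at hd
  obtain ⟨ζ, hζ, hζ1⟩ := exists_primitive_cube_root hL hke hk0
  have hsum : ∑ y : L with δ ^ 3 * y ^ 3 = 1, psi k (δ ^ 3 * y ^ 3 + δ ^ 3 * y) =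
      ∑ x : L with x ^ 3 = 1, psi k (δ ^ 2 * x) := by
    refine Finset.sum_bij' (fun y _ => δ * y) (fun x _ => δ⁻¹ * x) ?_ ?_ ?_ ?_ ?_
    · intro y hy
      simpa [mul_pow] using hy
    · intro x hx
      have hx : x ^ 3 = 1 := by simpa using hx
      simp [mul_pow, hx, hδ]
    · intro y _
      field_simp
    · intro x _
      field_simp
    · intro y hy
      have hy : δ ^ 3 * y ^ 3 = 1 := by simpa using hy
      rw [psi_add hL, hy, psi_one_of_even hke, one_mul]
      congr 1
      ring
  rw [hsum, sum_cube_roots_unity hζ hζ1] at hdvd hsq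
  have hprod : psi k (δ ^ 2 * 1) * (psi k (δ ^ 2 * ζ) * psi k (δ ^ 2 * ζ ^ 2)) = 1 := by
    rw [← psi_add hL, ← psi_add hL]
    have h0 : 1 + ζ + ζ ^ 2 = 0 := by
      apply mul_left_cancel₀ (sub_ne_zero.2 hζ1)
      linear_combination hζ
    rw [show δ ^ 2 * 1 + (δ ^ 2 * ζ + δ ^ 2 * ζ ^ 2) = δ ^ 2 * (1 + ζ + ζ ^ 2) by ring, h0,
      mul_zero, psi_zero]
  have h0 : 1 + (psi k (δ ^ 2 * 1) + (psi k (δ ^ 2 * ζ) + psi k (δ ^ 2 * ζ ^ 2))) = 0 := by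
    rcases psi_eq_one_or k (δ ^ 2 * 1) with h | h <;>
    rcases psi_eq_one_or k (δ ^ 2 * ζ) with h' | h' <;>
    rcases psi_eq_one_or k (δ ^ 2 * ζ ^ 2) with h'' | h'' <;>
    rw [h, h', h''] at hdvd hprod ⊢ <;> omega
  rw [h0, mul_zero] at hsq
  exact pow_eq_zero_iff two_ne_zero |>.1 hsq

end CubicSums

section QuadraticExtension

variable {F : Type*} [Field F]

lemma absTr_coe (K : Subfield F) (k : ℕ) (x : K) : absTr k (x : F) = (absTr k x : K) := by
  simp [absTr]

lemma psi_coe (K : Subfield F) (k : ℕ) (x : K) : psi k (x : F) = psi k x := by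
  simp [psi, sgn, absTr_coe]

lemma chi_coe (K : Subfield F) (k : ℕ) (x : K) : chi k (x : F) = (chi k x : K) := by
  simp [chi]

lemma ne_zero_of_unit {k : ℕ} {u : F} (hu : u ^ (2 ^ k + 1) = 1) : u ≠ 0 := by
  rintro rfl
  simp at hu

lemma inv_eq_of_unit {k : ℕ} {u : F} (hu : u ^ (2 ^ k + 1) = 1) : u⁻¹ = u ^ 2 ^ k :=
  inv_eq_of_mul_eq_one_right (by rw [← pow_succ', hu])

lemma sum_unit_cube [Fintype F] {k : ℕ} (hk : Even k) (h : F → ℤ) :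
    ∑ u : F with u ^ (2 ^ k + 1) = 1, h (u ^ 3) = ∑ u : F with u ^ (2 ^ k + 1) = 1, h u := by
  obtain ⟨r, hr⟩ : ∃ r, 2 ^ k + 1 = 3 * r + 2 := by
    have := three_mul_two_pow_sub_one_div hk
    have : 0 < 2 ^ k := by positivity
    exact ⟨(2 ^ k - 1) / 3, by omega⟩
  have hinv : ∀ u : F, u ^ (2 ^ k + 1) = 1 → u ^ (3 * (r + 1)) = u := fun u hu => by
    rw [show 3 * (r + 1) = 3 * r + 2 + 1 by ring, ← hr, pow_succ, hu, one_mul]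
  refine Finset.sum_bij' (fun u _ => u ^ 3) (fun u _ => u ^ (r + 1)) ?_ ?_ ?_ ?_ fun _ _ => rfl
  · intro u hu
    have hu : u ^ (2 ^ k + 1) = 1 := by simpa using hu
    simp only [Finset.mem_filter, Finset.mem_univ, true_and]
    rw [← pow_mul, mul_comm, pow_mul, hu, one_pow]
  · intro u hu
    have hu : u ^ (2 ^ k + 1) = 1 := by simpa using hu
    simp only [Finset.mem_filter, Finset.mem_univ, true_and]
    rw [← pow_mul, mul_comm, pow_mul, hu, one_pow]
  · intro u hu
    rw [← pow_mul, hinv u (by simpa using hu)]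
  · intro u hu
    rw [← pow_mul, mul_comm, hinv u (by simpa using hu)]

variable [CharP F 2]

variable (F) in
/-- The fixed field of `x ↦ x^(2^k)`. -/
def gfField (k : ℕ) : Subfield F := (iterateFrobenius F 2 k).eqLocusField (RingHom.id F)

lemma mem_gfField {k : ℕ} {x : F} : x ∈ gfField F k ↔ x ^ 2 ^ k = x := Iff.rfl

lemma absTr_add_self (k : ℕ) (x : F) : absTr (k + k) x = absTr k (x + x ^ 2 ^ k) := by
  rw [absTr_add, absTr, Finset.sum_range_add]
  simp only [absTr]
  congr 1
  exact Finset.sum_congr rfl fun i _ => by rw [← pow_mul, ← pow_add]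

instance (k : ℕ) : CharP (gfField F k) 2 :=
  (algebraMap (gfField F k) F).charP_iff Subtype.val_injective 2 |>.2 inferInstance

lemma unit_add_inv_mem {k : ℕ} {u : F} (hu : u ^ (2 ^ k + 1) = 1) : u + u⁻¹ ∈ gfField F k := by
  rw [mem_gfField, add_pow_char_pow, ← inv_eq_of_unit hu, inv_pow, ← inv_eq_of_unit hu, inv_inv,
    add_comm]

lemma eq_one_of_unit_of_mem {k : ℕ} {u : F} (hu : u ^ (2 ^ k + 1) = 1) (h : u ∈ gfField F k) :
    u = 1 := by
  rw [pow_succ, mem_gfField.1 h, ← pow_two] at hu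
  exact frobenius_inj F 2 (by simpa [frobenius_def] using hu)

variable [Fintype F] {k : ℕ}

lemma sum_gfField {M : Type*} [AddCommMonoid M] (h : F → M) :
    ∑ x : F with x ∈ gfField F k, h x = ∑ x : gfField F k, h x :=
  Finset.sum_subtype _ (by simp) h

lemma card_gfField (hF : Fintype.card F = 2 ^ (k + k)) (hk : k ≠ 0) :
    Fintype.card (gfField F k) = 2 ^ k := by
  have hcard : Fintype.card (gfField F k) = #{x : F | x ∈ gfField F k} :=
    Fintype.card_of_subtype _ (by simp)
  apply le_antisymm
  · have h1 : 1 < 2 ^ k := Nat.one_lt_two_pow hk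
    have hdeg := FiniteField.X_pow_card_sub_X_natDegree_eq F h1
    have hne := FiniteField.X_pow_card_sub_X_ne_zero F h1
    rw [hcard, ← hdeg]
    refine Polynomial.card_le_degree_of_subset_roots (p := Polynomial.X ^ 2 ^ k - Polynomial.X)
      fun x hx => ?_
    have hx : x ∈ gfField F k := by simpa using hx
    rw [Polynomial.mem_roots hne]
    simp [mem_gfField.1 hx]
  · have h1 := Finset.card_le_mul_card_image (s := (Finset.univ : Finset F))
      (f := fun x => x + x ^ 2 ^ k) (Fintype.card (gfField F k)) (fun y hy => by
        obtain ⟨x₀, -, rfl⟩ := Finset.mem_image.1 hy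
        rw [hcard]
        refine Finset.card_le_card_of_injOn (fun x => x + x₀) ?_ (fun x _ y _ h => by simpa using h)
        intro x hx
        have hx : x + x ^ 2 ^ k = x₀ + x₀ ^ 2 ^ k := by simpa using hx
        simp only [Finset.coe_filter, Finset.mem_univ, true_and, Set.mem_ofPred_eq, mem_gfField]
        rw [add_pow_char_pow]
        linear_combination hx + (x₀ ^ 2 ^ k - x) * (CharTwo.two_eq_zero (R := F)))
    have h2 : #(Finset.univ.image fun x : F => x + x ^ 2 ^ k) ≤ Fintype.card (gfField F k) := by
      rw [hcard]
      refine Finset.card_le_card fun y hy => ?_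
      obtain ⟨x, -, rfl⟩ := Finset.mem_image.1 hy
      have hx := pow_two_pow_card hF x
      rw [pow_add, pow_mul] at hx
      simp only [Finset.mem_filter, Finset.mem_univ, true_and, mem_gfField]
      rw [add_pow_char_pow, hx, add_comm]
    rw [Finset.card_univ, hF, pow_add] at h1
    exact Nat.mul_self_le_mul_self_iff.1 (h1.trans (Nat.mul_le_mul_left _ h2))

lemma card_unit_add_inv_eq (hF : Fintype.card F = 2 ^ (k + k)) (hk : k ≠ 0) {s : gfField F k}
    (hs : s ≠ 0) :
    (#{u : F | u ^ (2 ^ k + 1) = 1 ∧ u + u⁻¹ = s} : ℤ) = 1 - psi k s⁻¹ := by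
  have hsF : (s : F) ≠ 0 := by simpa using hs
  have h1 := card_add_inv_eq hF (by omega) hsF
  have h2 : psi (k + k) (s : F)⁻¹ = 1 := by
    have : ((s : F)⁻¹) ^ 2 ^ k = (s : F)⁻¹ := by rw [inv_pow, mem_gfField.1 s.2]
    rw [psi, absTr_add_self, this, CharTwo.add_self_eq_zero]
    simp [sgn]
  have h3 := card_add_inv_eq (card_gfField hF hk) hk hs
  rw [h2, ← Finset.card_filter_add_card_filter_not (fun z : F => z ∈ gfField F k)] at h1
  have h4 : #{z : gfField F k | z ≠ 0 ∧ z + z⁻¹ = s} =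
      #((Finset.univ.filter fun z : F => z ≠ 0 ∧ z + z⁻¹ = s).filter
        fun z => z ∈ gfField F k) := by
    refine Finset.card_bij (fun z _ => (z : F)) ?_ (fun _ _ _ _ h => Subtype.val_injective h) ?_
    · intro z hz
      obtain ⟨h0, h⟩ : z ≠ 0 ∧ z + z⁻¹ = s := by simpa using hz
      simp [h0, ← h]
    · intro z hz
      simp only [Finset.mem_filter, Finset.mem_univ, true_and] at hz
      refine ⟨⟨z, hz.2⟩, ?_, rfl⟩
      simp only [Finset.mem_filter, Finset.mem_univ, true_and]
      exact ⟨fun h => hz.1.1 (congrArg Subtype.val h), Subtype.ext hz.1.2⟩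
  have h5 : (Finset.univ.filter fun z : F => z ≠ 0 ∧ z + z⁻¹ = s).filter
      (fun z => z ∉ gfField F k) =
      Finset.univ.filter fun u : F => u ^ (2 ^ k + 1) = 1 ∧ u + u⁻¹ = s := by
    ext z
    simp only [Finset.mem_filter, Finset.mem_univ, true_and]
    constructor
    · rintro ⟨⟨h0, h⟩, hz⟩
      refine ⟨?_, h⟩
      have h6 : (z + z⁻¹) ^ 2 ^ k = z + z⁻¹ := by rw [h]; exact s.2
      rw [add_pow_char_pow, inv_pow] at h6
      have h7 : (z ^ 2 ^ k - z) * (z ^ (2 ^ k + 1) - 1) = 0 := by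
        have h8 : z ^ 2 ^ k ≠ 0 := pow_ne_zero _ h0
        rw [pow_succ]
        field_simp at h6
        linear_combination h6
      rcases mul_eq_zero.1 h7 with h | h
      · exact absurd (mem_gfField.2 (sub_eq_zero.1 h)) hz
      · exact sub_eq_zero.1 h
    · rintro ⟨hu, h⟩
      refine ⟨⟨ne_zero_of_unit hu, h⟩, fun hz => hsF ?_⟩
      rw [← h, eq_one_of_unit_of_mem hu hz, inv_one, CharTwo.add_self_eq_zero]
  rw [h5, ← h4] at h1
  push_cast at h1
  linarith

lemma sum_unit_add_inv (hF : Fintype.card F = 2 ^ (k + k)) (hk : k ≠ 0) (g : F → ℤ) :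
    ∑ u : F with u ^ (2 ^ k + 1) = 1, g (u + u⁻¹) =
      g 0 + ∑ s : gfField F k, (1 - psi k s⁻¹) * g s := by
  have h : ∀ s : gfField F k, (#{u : F | u ^ (2 ^ k + 1) = 1 ∧ u + u⁻¹ = s} : ℤ) * g s =
      (if s = 0 then g 0 else 0) + (1 - psi k s⁻¹) * g s := fun s => by
    split_ifs with hs
    · subst hs
      have : (Finset.univ.filter fun u : F => u ^ (2 ^ k + 1) = 1 ∧ u + u⁻¹ =
          ((0 : gfField F k) : F)) = {1} := by
        ext z
        simp only [Finset.mem_filter, Finset.mem_univ, true_and, Finset.mem_singleton,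
          ZeroMemClass.coe_zero]
        constructor
        · rintro ⟨hu, h⟩
          refine eq_one_of_unit_of_mem hu ?_
          rw [mem_gfField, ← inv_eq_of_unit hu]
          exact (CharTwo.add_eq_zero.1 h).symm
        · rintro rfl
          simp [CharTwo.add_self_eq_zero]
      rw [this]
      simp
    · rw [card_unit_add_inv_eq hF hk hs, zero_add]
  rw [← Finset.sum_fiberwise_of_maps_to
    (s := Finset.univ.filter fun u : F => u ^ (2 ^ k + 1) = 1)
    (t := Finset.univ.filter fun x : F => x ∈ gfField F k) (g := fun u => u + u⁻¹)
    (fun u hu => by simpa using unit_add_inv_mem (by simpa using hu)), sum_gfField]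
  calc _ = ∑ s : gfField F k, (#{u : F | u ^ (2 ^ k + 1) = 1 ∧ u + u⁻¹ = s} : ℤ) * g s := by
        refine Finset.sum_congr rfl fun s _ => ?_
        rw [← Finset.filter_filter, ← nsmul_eq_mul, ← Finset.sum_const]
        refine Finset.sum_congr rfl fun z hz => ?_
        rw [(Finset.mem_filter.1 hz).2]
    _ = _ := by
        simp_rw [h]
        rw [Finset.sum_add_distrib, Finset.sum_ite_eq' Finset.univ (0 : gfField F k)]
        simp

/-- The Kloosterman sum over the fixed field of `x ↦ x^(2^k)`. -/
lemma kloo_coe (c : gfField F k) :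
    kloo k (c : F) = ∑ x : gfField F k, psi k (c * x + x⁻¹) := by
  have : gf F k = Finset.univ.filter fun x : F => x ∈ gfField F k := rfl
  rw [kloo, this, sum_gfField]
  refine Finset.sum_congr rfl fun x _ => ?_
  rw [← psi_coe]
  simp [psi]

lemma kloo_sq (hF : Fintype.card F = 2 ^ (k + k)) (hk : k ≠ 0) (c : gfField F k) :
    kloo k ((c : F) ^ 2) = kloo k (c : F) := by
  rw [← SubmonoidClass.coe_pow, kloo_coe, kloo_coe, ← sum_sq_eq]
  refine Finset.sum_congr rfl fun x _ => ?_
  rw [← psi_sq (card_gfField hF hk) (c * x + x⁻¹), CharTwo.add_sq, mul_pow, inv_pow]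

lemma sum_unit_psi (hF : Fintype.card F = 2 ^ (k + k)) (hk : k ≠ 0) {c : gfField F k}
    (hc : c ≠ 0) :
    ∑ u : F with u ^ (2 ^ k + 1) = 1, psi k (c * (u + u⁻¹)) = 1 - kloo k (c : F) := by
  have hL := card_gfField hF hk
  rw [sum_unit_add_inv hF hk (fun x => psi k (c * x)), kloo_coe]
  have h : ∀ s : gfField F k, (1 - psi k s⁻¹) * psi k ((c : F) * s) =
      psi k (c * s) - psi k (c * s + s⁻¹) := fun s => by
    rw [← MulMemClass.coe_mul, psi_coe, psi_add hL]
    ring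
  simp_rw [h]
  rw [Finset.sum_sub_distrib, sum_psi_mul hL hk, if_neg hc]
  simp
  ring

lemma dickson_three {R : Type*} [Field R] [CharP R 2] {z : R} (hz : z ≠ 0) :
    (z + z⁻¹) ^ 3 + (z + z⁻¹) = z ^ 3 + (z ^ 3)⁻¹ := by
  field_simp
  linear_combination (2 * z ^ 4 + 2 * z ^ 2) * (CharTwo.two_eq_zero (R := R))

lemma sum_psi_cube_add_inv (hF : Fintype.card F = 2 ^ (k + k)) (hk : Even k) (hk0 : k ≠ 0)
    {d : gfField F k} (hd : d ≠ 0) :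
    ∑ z : gfField F k with z ≠ 0, psi k (d * (z ^ 3 + (z ^ 3)⁻¹)) =
      2 * ∑ x : gfField F k, psi k (d * x ^ 3 + d * x) - 1 + kloo k (d : F) := by
  have hL := card_gfField hF hk0
  have h1 := sum_add_inv hL hk0 (fun x => psi k (d * (x ^ 3 + x)))
  have h2 := sum_unit_add_inv hF hk0 (fun x => psi k (d * (x ^ 3 + x)))
  have h3 : ∑ u : F with u ^ (2 ^ k + 1) = 1, psi k (d * ((u + u⁻¹) ^ 3 + (u + u⁻¹))) =
      1 - kloo k (d : F) := by
    rw [← sum_unit_psi hF hk0 hd, ← sum_unit_cube hk (fun x : F => psi k ((d : F) * (x + x⁻¹)))]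
    refine Finset.sum_congr rfl fun u hu => ?_
    rw [dickson_three (ne_zero_of_unit (by simpa using hu))]
  have h4 : ∑ z : gfField F k with z ≠ 0, psi k (d * ((z + z⁻¹) ^ 3 + (z + z⁻¹))) =
      ∑ z : gfField F k with z ≠ 0, psi k (d * (z ^ 3 + (z ^ 3)⁻¹)) :=
    Finset.sum_congr rfl fun z hz => by rw [dickson_three (by simpa using hz)]
  have h5 : ∀ s : gfField F k, psi k ((d : F) * ((s : F) ^ 3 + s)) = psi k (d * (s ^ 3 + s)) :=
    fun s => by rw [← psi_coe]; simp
  rw [h4] at h1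
  rw [h3] at h2
  simp_rw [h5] at h2
  simp only [add_mul, sub_mul, one_mul, Finset.sum_add_distrib, Finset.sum_sub_distrib] at h1 h2
  simp only [mul_add] at h1 h2 ⊢
  simp only [ne_eq, OfNat.ofNat_ne_zero, not_false_eq_true, zero_pow, mul_zero, add_zero,
    psi_zero] at h1 h2 ⊢
  linarith

/-- If `K(d²) ≡ 1 (mod 3)` then `d` is a cube and the Kloosterman sum is equidistributed over
the classes of the cubic character. -/
lemma kloo_equidistributed (hF : Fintype.card F = 2 ^ (k + k)) (hk : Even k) (hk0 : k ≠ 0)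
    {d : gfField F k} (hd : d ≠ 0) (hK : kloo k (d : F) ≡ 1 [ZMOD 3]) :
    chi k d = 1 ∧ ∀ c : gfField F k, c ^ 3 = 1 →
      3 * ∑ v : gfField F k with chi k v = c, psi k (d ^ 2 * v + v⁻¹) = kloo k (d : F) - 1 := by
  have hL := card_gfField hF hk0
  have h1 := sum_psi_cube_add_inv hF hk hk0 hd
  have h3 : (3 : ℤ) ∣ ∑ x : gfField F k, psi k (d * x ^ 3 + d * x) := by
    rw [sum_cubes hL hk hk0 (fun z => psi k (d * (z + z⁻¹)))] at h1
    have := hK.symm.dvd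
    omega
  obtain ⟨hchi, hC⟩ := isCube_and_cubic_sum_eq_zero hL hk hk0 hd h3
  refine ⟨hchi, fun c hc => ?_⟩
  have hsub : ∀ v : gfField F k, psi k (d ^ 2 * (d⁻¹ * v) + (d⁻¹ * v)⁻¹) =
      psi k (d * (v + v⁻¹)) := fun v => by
    congr 1
    rw [mul_inv, inv_inv]
    field_simp
  rw [hC, mul_zero, zero_sub, neg_add_eq_sub] at h1
  rw [← sum_psi_chi_inv hL hk hk0 h1 _ hc]
  · rw [Finset.sum_filter, ← Equiv.sum_comp (Equiv.mulLeft₀ d⁻¹ (inv_ne_zero hd)),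
      Finset.sum_filter]
    congr 1
    refine Finset.sum_congr rfl fun v _ => ?_
    rw [show Equiv.mulLeft₀ d⁻¹ (inv_ne_zero hd) v = d⁻¹ * v from rfl, hsub, chi_mul, chi_inv,
      hchi, inv_one, one_mul]
  · rw [← kloo_sq hF hk0, ← SubmonoidClass.coe_pow, kloo_coe]
    exact (Finset.sum_congr rfl fun v _ => (hsub v).symm).trans
      (Equiv.sum_comp (Equiv.mulLeft₀ d⁻¹ (inv_ne_zero hd)) fun x => psi k (d ^ 2 * x + x⁻¹))

end QuadraticExtension

section Polar

variable {F : Type*} [Field F]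

lemma pow_two_pow_sub_one {k : ℕ} {z : F} (hz0 : z ≠ 0) (hz : z ^ 2 ^ k = z) :
    z ^ (2 ^ k - 1) = 1 := by
  apply mul_right_cancel₀ hz0
  rw [← pow_succ, Nat.sub_add_cancel Nat.one_le_two_pow, hz, one_mul]

lemma chi_pow_three_of_pow_eq {k : ℕ} (hk : Even k) {z : F} (hz0 : z ≠ 0) (hz : z ^ 2 ^ k = z) :
    chi k z ^ 3 = 1 := by
  rw [chi, ← pow_mul, mul_comm, three_mul_two_pow_sub_one_div hk, pow_two_pow_sub_one hz0 hz]

lemma pow_two_pow_of_cube_eq_one {k : ℕ} (hk : Even k) {b : F} (hb : b ^ 3 = 1) :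
    b ^ 2 ^ k = b := by
  rw [← Nat.sub_add_cancel (n := 2 ^ k) Nat.one_le_two_pow, ← three_mul_two_pow_sub_one_div hk,
    pow_succ, pow_mul, hb, one_pow, one_mul]

lemma chi_add_self {k : ℕ} (hk : Even k) (x : F) : chi (k + k) x = chi k (x ^ (2 ^ k + 1)) := by
  have h := three_mul_two_pow_sub_one_div hk
  have h' : 2 ^ (k + k) - 1 = 3 * ((2 ^ k + 1) * ((2 ^ k - 1) / 3)) := by
    rw [mul_left_comm, h, pow_add, ← Nat.sq_sub_sq, one_pow, pow_two]
  rw [chi, chi, ← pow_mul, h', Nat.mul_div_cancel_left _ three_pos]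

lemma chi_unit_mul {k : ℕ} (hk : Even k) {u z : F} (hu : u ^ (2 ^ k + 1) = 1)
    (hz : z ^ 2 ^ k = z) : chi (k + k) (u * z) = chi k z ^ 2 := by
  rw [chi_add_self hk, mul_pow, hu, one_mul, pow_succ, hz, chi_mul, pow_two]

lemma chi_eq_one_of_odd {j : ℕ} (hj : Odd j) {y : F} (hy : y ^ 2 ^ j = y) (hy0 : y ≠ 0) :
    chi (2 * j) y = 1 := by
  obtain ⟨i, rfl⟩ := hj
  obtain ⟨r, hr⟩ : ∃ r, 2 ^ (2 * i + 1) + 1 = 3 * r := by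
    have h : 4 ^ i % 3 = 1 := by norm_num [Nat.pow_mod]
    refine ⟨(2 * 4 ^ i + 1) / 3, ?_⟩
    rw [pow_succ, pow_mul]
    norm_num
    omega
  have h1 := pow_two_pow_sub_one hy0 hy
  have h2 : 2 ^ (2 * (2 * i + 1)) - 1 = 3 * (r * (2 ^ (2 * i + 1) - 1)) := by
    rw [← mul_assoc, ← hr, ← Nat.sq_sub_sq, one_pow, ← pow_mul, mul_comm (2 * i + 1)]
  rw [chi, h2, Nat.mul_div_cancel_left _ three_pos, mul_comm r, pow_mul, h1, one_pow]

lemma pow_sub_one_of_unit {k : ℕ} {u : F} (hu : u ^ (2 ^ k + 1) = 1) :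
    u ^ (2 ^ k - 1) = u⁻¹ ^ 2 := by
  have hu0 := ne_zero_of_unit hu
  apply mul_right_cancel₀ hu0
  rw [← pow_succ, Nat.sub_add_cancel Nat.one_le_two_pow, ← inv_eq_of_unit hu]
  field_simp

variable [CharP F 2]

lemma sgn_tr2 {r : F} (hr : r ^ 3 = 1) : sgn (tr2 r) = 2 * (if r = 1 then 1 else 0) - 1 := by
  split_ifs with h
  · simp [h, tr2, sgn, CharTwo.add_self_eq_zero]
  · have h1 : tr2 r = 1 := by
      rw [tr2]
      apply mul_left_cancel₀ (sub_ne_zero.2 h)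
      linear_combination hr + (1 - r) * (CharTwo.two_eq_zero (R := F))
    simp [h1, sgn]

lemma tr2_sq {r : F} (hr : r ^ 3 = 1) : tr2 r ^ 2 = tr2 r := by
  rw [tr2]
  linear_combination (r + 2) * hr + CharTwo.two_eq_zero (R := F)

lemma psi_unit_mul {k : ℕ} {u z ω : F} (hu : u ^ (2 ^ k + 1) = 1) (hz : z ^ 2 ^ k = z)
    (hω : ω ^ 2 ^ k = ω) :
    psi (k + k) (ω * (u * z)) = psi k (ω * (u + u⁻¹) * z) := by
  rw [psi, psi, absTr_add_self, mul_pow, mul_pow, hz, hω, ← inv_eq_of_unit hu]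
  congr 2
  ring

variable [Fintype F] {k : ℕ}

lemma exists_polar {x : F} (hx0 : x ≠ 0) (hx : x ^ 2 ^ (k + k) = x) :
    ∃ u : F, u ^ (2 ^ k + 1) = 1 ∧ (u⁻¹ * x) ^ 2 ^ k = u⁻¹ * x := by
  obtain ⟨u, hu⟩ := sq_bijective.2 (x * (x ^ 2 ^ k)⁻¹)
  replace hu : u ^ 2 = x * (x ^ 2 ^ k)⁻¹ := hu
  rw [pow_add, pow_mul] at hx
  have hxk : x ^ 2 ^ k ≠ 0 := pow_ne_zero _ hx0
  have h1 : u ^ (2 ^ k + 1) = 1 := by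
    apply sq_bijective.1
    simp only
    rw [← pow_mul, mul_comm, pow_mul, hu, pow_succ, mul_pow, inv_pow, hx]
    field_simp
  refine ⟨u, h1, ?_⟩
  have hu0 := ne_zero_of_unit h1
  rw [mul_pow, inv_pow, ← inv_eq_of_unit h1, inv_inv]
  apply mul_left_cancel₀ hu0
  rw [← mul_assoc, ← pow_two, hu]
  field_simp

lemma sum_polar (hF : Fintype.card F = 2 ^ (k + k)) (h : F → ℤ) :
    ∑ x : F with x ≠ 0, h x =
      ∑ u : F with u ^ (2 ^ k + 1) = 1, ∑ z : gfField F k with z ≠ 0, h (u * z) := by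
  rw [← Finset.sum_product']
  symm
  refine Finset.sum_bij (fun p _ => p.1 * (p.2 : F)) ?_ ?_ ?_ fun _ _ => rfl
  · rintro ⟨u, z⟩ hp
    obtain ⟨hu, hz⟩ : u ^ (2 ^ k + 1) = 1 ∧ z ≠ 0 := by simpa using hp
    simp [ne_zero_of_unit hu, hz]
  · rintro ⟨u, z⟩ hp ⟨v, w⟩ hq heq
    obtain ⟨hu, hz⟩ : u ^ (2 ^ k + 1) = 1 ∧ z ≠ 0 := by simpa using hp
    obtain ⟨hv, hw⟩ : v ^ (2 ^ k + 1) = 1 ∧ w ≠ 0 := by simpa using hq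
    have heq : u * (z : F) = v * (w : F) := heq
    have hz' : (z : F) ≠ 0 := by simpa using hz
    have hv0 := ne_zero_of_unit hv
    have h1 : u * v⁻¹ = w / z := by
      field_simp
      exact heq
    have h2 : u * v⁻¹ = 1 := by
      refine eq_one_of_unit_of_mem (k := k) ?_ ?_
      · rw [mul_pow, inv_pow, hu, hv, inv_one, one_mul]
      · rw [h1]
        exact div_mem w.2 z.2
    obtain rfl : u = v := by rwa [mul_inv_eq_one₀ hv0] at h2
    simpa [hv0] using heq
  · intro x hx
    obtain ⟨u, hu, hz⟩ := exists_polar (by simpa using hx) (pow_two_pow_card hF x)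
    have hu0 := ne_zero_of_unit hu
    refine ⟨(u, ⟨u⁻¹ * x, hz⟩), ?_, by simp [hu0]⟩
    have hx0 : x ≠ 0 := by simpa using hx
    simp only [Finset.mem_product, Finset.mem_filter, Finset.mem_univ, true_and]
    refine ⟨hu, fun h0 => ?_⟩
    simpa [hu0, hx0] using congrArg Subtype.val h0

lemma sgn_fA (hF : Fintype.card F = 2 ^ (k + k)) (hk : k ≠ 0) (e : gfField F k) {u z : F}
    (hu : u ^ (2 ^ k + 1) = 1) (hz0 : z ≠ 0) (hz : z ^ 2 ^ k = z) :
    sgn (fA (k + k) k ((e : F) ^ 2) (u * z)) = psi k ((e : F) * (u + u⁻¹)) := by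
  have hz1 := pow_two_pow_sub_one hz0 hz
  have he : (e : F) ^ 2 ^ k = e := e.2
  obtain ⟨s, hs⟩ : ∃ s : gfField F k, (s : F) = u + u⁻¹ := ⟨⟨_, unit_add_inv_mem hu⟩, rfl⟩
  have h1 : (e : F) ^ 2 * (u⁻¹ ^ 2) + ((e : F) ^ 2 * (u⁻¹ ^ 2)) ^ 2 ^ k =
      ((e * s) ^ 2 : gfField F k) := by
    rw [← mul_pow, pow_right_comm, mul_pow (e : F) u⁻¹ (2 ^ k), he, inv_pow, ← inv_eq_of_unit hu,
      inv_inv,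
      ← CharTwo.add_sq]
    push_cast
    rw [hs]
    ring
  rw [fA, mul_pow, hz1, mul_one, pow_sub_one_of_unit hu, absTr_add_self, h1]
  change psi k _ = _
  rw [psi_coe, psi_sq (card_gfField hF hk), ← psi_coe, MulMemClass.coe_mul, hs]

end Polar

section WalshTransform

lemma three_mul_sum_psi_mul_chi {L : Type*} [Field L] [Fintype L] [DecidableEq L] [CharP L 2]
    {k m : ℕ} (hL : Fintype.card L = 2 ^ k) (hm : Odd m) (hk : k = 2 * m) {e c : L} (he : e ≠ 0)
    (hc : c ^ 3 = 1) :
    3 * ∑ v : L with chi k v = c, psi k (e * v) =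
      if c * chi k e = 1 then 2 ^ (m + 1) - 1 else -2 ^ m - 1 := by
  have hke : Even k := hk ▸ even_two_mul m
  have he3 := chi_pow_three hL hke he
  rw [← three_mul_sum_psi_chi hL hm hk (c := c * chi k e) (by rw [mul_pow, hc, he3, one_mul])]
  congr 1
  refine Finset.sum_bij' (fun v _ => e * v) (fun v _ => e⁻¹ * v) ?_ ?_ ?_ ?_ fun _ _ => rfl
  · intro v hv
    have hv : chi k v = c := by simpa using hv
    simp [chi_mul, hv, mul_comm]
  · intro v hv
    have hv : chi k v = c * chi k e := by simpa using hv
    have he0 : chi k e ≠ 0 := fun h => by simp [h] at he3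
    simp only [Finset.mem_filter, Finset.mem_univ, true_and, chi_mul, chi_inv, hv]
    field_simp
  · intro v _
    field_simp
  · intro v _
    field_simp

variable {F : Type*} [Field F]

lemma relTr_two_mul {k : ℕ} (hk : k ≠ 0) (x : F) : relTr (k + k) k x = x + x ^ 2 ^ k := by
  have h : (k + k) / k = 2 := by rw [← two_mul, Nat.mul_div_cancel _ (Nat.pos_of_ne_zero hk)]
  rw [relTr, h, Finset.sum_range_succ, Finset.sum_range_one, mul_zero, pow_zero, pow_one, mul_one]

lemma mul_add_mul_pow_of_unit {k : ℕ} {u c : F} (hu : u ^ (2 ^ k + 1) = 1) (hc : c ^ 2 ^ k = c) :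
    u * c + (u * c) ^ 2 ^ k = c * (u + u⁻¹) := by
  rw [mul_pow, hc, ← inv_eq_of_unit hu]
  ring

lemma unit_pow_two_mul {j : ℕ} {u : F} (hu : u ^ (2 ^ j + 1) = 1) : u ^ 2 ^ (2 * j) = u := by
  rw [two_mul, pow_add, pow_mul, ← inv_eq_of_unit hu, inv_pow, ← inv_eq_of_unit hu, inv_inv]

lemma mul_chi_eq_one_iff {m : ℕ} (hm : Odd m) {b c u : F} (hc0 : c ≠ 0) (hu : u ^ (2 ^ m + 1) = 1)
    (huc : (u * c) ^ 2 ^ m = u * c) :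
    b * chi (2 * m + 2 * m) u = 1 ↔ b * chi (2 * m) c = 1 := by
  have hke : Even (2 * m) := even_two_mul m
  have hu0 := ne_zero_of_unit hu
  have h1 := chi_unit_mul hke (one_pow (2 ^ (2 * m) + 1)) (unit_pow_two_mul hu)
  rw [one_mul] at h1
  have h2 := chi_eq_one_of_odd hm huc (mul_ne_zero hu0 hc0)
  rw [chi_mul] at h2
  have h3 := chi_pow_three_of_pow_eq hke hu0 (unit_pow_two_mul hu)
  have h4 : chi (2 * m) c = chi (2 * m) u ^ 2 := by
    linear_combination chi (2 * m) u ^ 2 * h2 - chi (2 * m) c * h3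
  rw [h1, h4]

variable [CharP F 2]

lemma relTr_four_mul {j : ℕ} (hj : j ≠ 0) (x : F) :
    relTr (2 * j + 2 * j) j x =
      (x + x ^ 2 ^ (2 * j)) + (x + x ^ 2 ^ (2 * j)) ^ 2 ^ j := by
  rw [relTr, ← add_mul, Nat.mul_div_cancel _ (Nat.pos_of_ne_zero hj), add_pow_char_pow, ← pow_mul,
    ← pow_add]
  simp only [Finset.sum_range_succ, Finset.sum_range_zero, mul_zero, pow_zero, pow_one, mul_one,
    zero_add]
  ring_nf

variable [Fintype F]

lemma S2_eq_sum {m : ℕ} (hm : Odd m) (hF : Fintype.card F = 2 ^ (2 * m + 2 * m))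
    (e : gfField F (2 * m)) {b ω : F} (hω : ω ^ 2 ^ (2 * m) = ω) :
    S2 (2 * m + 2 * m) (2 * m) m ((e : F) ^ 2) b ω =
      ∑ u : F with u ^ (2 ^ (2 * m) + 1) = 1,
        if b * chi (2 * m) (ω * (u + u⁻¹)) = 1 then psi (2 * m) ((e : F) * (u + u⁻¹)) else 0 := by
  have hm0 : m ≠ 0 := by grind
  have hk0 : 2 * m ≠ 0 := by omega
  have hke : Even (2 * m) := even_two_mul m
  have hrel : ∀ u₁ u₂ : F, u₁ ^ (2 ^ (2 * m) + 1) = 1 → u₂ ^ (2 ^ m + 1) = 1 →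
      relTr (2 * m + 2 * m) (2 * m) (u₁ * u₂ * ω) = u₂ * (ω * (u₁ + u₁⁻¹)) ∧
      relTr (2 * m + 2 * m) m (u₁ * u₂ * ω) = u₂ * (ω * (u₁ + u₁⁻¹)) +
        (u₂ * (ω * (u₁ + u₁⁻¹))) ^ 2 ^ m := fun u₁ u₂ h₁ h₂ => by
    rw [relTr_two_mul hk0, relTr_four_mul hm0, mul_assoc, mul_add_mul_pow_of_unit h₁
      (by rw [mul_pow, hω, unit_pow_two_mul h₂]), mul_assoc]
    exact ⟨rfl, rfl⟩
  have hmem : ∀ u : F, u ^ (2 ^ (2 * m) + 1) = 1 →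
      (ω * (u + u⁻¹)) ^ 2 ^ (2 * m) = ω * (u + u⁻¹) := fun u hu => by
    rw [mul_pow, hω, mem_gfField.1 (unit_add_inv_mem hu)]
  rw [S2, ← Finset.sum_filter, Finset.filter_filter]
  refine Finset.sum_bij (fun p _ => p.1) ?_ ?_ ?_ ?_
  · rintro ⟨u₁, u₂⟩ hp
    obtain ⟨h₁, h₂, h₃, h₄, h₅⟩ := (Finset.mem_filter.1 hp).2
    dsimp only at h₁ h₂ h₃ h₄ h₅ ⊢
    rw [(hrel u₁ u₂ h₁ h₂).1] at h₃
    rw [(hrel u₁ u₂ h₁ h₂).2] at h₄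
    have hc0 := right_ne_zero_of_mul h₃
    rw [mul_chi_eq_one_iff hm hc0 h₂ (CharTwo.add_eq_zero.1 h₄).symm] at h₅
    exact Finset.mem_filter.2 ⟨Finset.mem_univ _, h₁, h₅⟩
  · rintro ⟨u₁, u₂⟩ hp ⟨v₁, v₂⟩ hq heq
    obtain rfl : u₁ = v₁ := heq
    obtain ⟨h₁, h₂, h₃, h₄, -⟩ := (Finset.mem_filter.1 hp).2
    obtain ⟨-, h₂', -, h₄', -⟩ := (Finset.mem_filter.1 hq).2
    dsimp only at h₁ h₂ h₃ h₄ h₂' h₄'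
    rw [(hrel u₁ u₂ h₁ h₂).1] at h₃
    rw [(hrel u₁ u₂ h₁ h₂).2] at h₄
    rw [(hrel u₁ v₂ h₁ h₂').2] at h₄'
    have hc0 := right_ne_zero_of_mul h₃
    have hv0 := ne_zero_of_unit h₂'
    have h5 : u₂ * v₂⁻¹ = 1 := by
      refine eq_one_of_unit_of_mem (k := m) (by rw [mul_pow, inv_pow, h₂, h₂', inv_one, one_mul]) ?_
      rw [show u₂ * v₂⁻¹ = u₂ * (ω * (u₁ + u₁⁻¹)) / (v₂ * (ω * (u₁ + u₁⁻¹))) by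
        rw [mul_div_mul_right _ _ hc0, div_eq_mul_inv]]
      exact div_mem (CharTwo.add_eq_zero.1 h₄).symm (CharTwo.add_eq_zero.1 h₄').symm
    rw [mul_inv_eq_one₀ hv0] at h5
    rw [h5]
  · intro u hu
    obtain ⟨h₁, h₅⟩ := (Finset.mem_filter.1 hu).2
    have hc0 : ω * (u + u⁻¹) ≠ 0 := fun h => by simp [h, chi_zero hke hk0] at h₅
    obtain ⟨v, hv, hvc⟩ := exists_polar (k := m) hc0 (by rw [← two_mul, hmem u h₁])
    have hv' : v⁻¹ ^ (2 ^ m + 1) = 1 := by rw [inv_pow, hv, inv_one]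
    refine ⟨(u, v⁻¹), Finset.mem_filter.2 ⟨Finset.mem_univ _, h₁, hv', ?_, ?_, ?_⟩, rfl⟩
    · rw [(hrel u _ h₁ hv').1]
      exact mul_ne_zero (ne_zero_of_unit hv') hc0
    · rw [(hrel u _ h₁ hv').2, hvc, CharTwo.add_self_eq_zero]
    · exact (mul_chi_eq_one_iff hm hc0 hv' hvc).2 h₅
  · rintro ⟨u₁, u₂⟩ hp
    have h₁ := (Finset.mem_filter.1 hp).2.1
    have := sgn_fA hF hk0 e h₁ one_ne_zero (one_pow _)
    rwa [mul_one] at this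

lemma three_mul_S2 {m : ℕ} (hm : Odd m) (hF : Fintype.card F = 2 ^ (2 * m + 2 * m))
    {e : gfField F (2 * m)} (he : e ≠ 0) (hK : kloo (2 * m) (e : F) ≡ 1 [ZMOD 3])
    {b ω : F} (hb : b ^ 3 = 1) (hω : ω ^ 2 ^ (2 * m) = ω) (hω0 : ω ≠ 0) :
    3 * S2 (2 * m + 2 * m) (2 * m) m ((e : F) ^ 2) b ω =
      (if b * chi (2 * m) ω = 1 then 2 ^ (m + 1) - 1 else -2 ^ m - 1) -
        (kloo (2 * m) (e : F) - 1) := by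
  have hk0 : 2 * m ≠ 0 := by grind
  have hke : Even (2 * m) := even_two_mul m
  have hL := card_gfField hF hk0
  obtain ⟨d, rfl⟩ := sq_bijective.2 e
  replace he : d ≠ 0 := fun h => he (by simp [h])
  simp only [SubmonoidClass.coe_pow] at hK ⊢
  rw [kloo_sq hF hk0] at hK ⊢
  obtain ⟨hd, hdist⟩ := kloo_equidistributed hF hke hk0 he hK
  have hbK := pow_two_pow_of_cube_eq_one hke hb
  have hω3 : chi (2 * m) (⟨ω, hω⟩ : gfField F (2 * m)) ^ 3 = 1 :=
    chi_pow_three hL hke fun h => hω0 (congrArg Subtype.val h)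
  obtain ⟨β, hβ⟩ : ∃ β : gfField F (2 * m), β = ⟨b, hbK⟩ * chi (2 * m) ⟨ω, hω⟩ := ⟨_, rfl⟩
  have hβF : (β : F) = b * chi (2 * m) ω := by rw [hβ, MulMemClass.coe_mul, ← chi_coe]
  have hβ3 : β ^ 3 = 1 := by
    rw [hβ, mul_pow, hω3, mul_one]
    exact Subtype.ext (by simpa using hb)
  have hβ0 : β ≠ 0 := fun h => by simp [h] at hβ3
  have hβi : β⁻¹ ^ 3 = 1 := by rw [inv_pow, hβ3, inv_one]
  have key : S2 (2 * m + 2 * m) (2 * m) m (((d : F) ^ 2) ^ 2) b ω =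
      ∑ s : gfField F (2 * m) with chi (2 * m) s = β⁻¹, psi (2 * m) (d ^ 2 * s) -
      ∑ s : gfField F (2 * m) with chi (2 * m) s = β⁻¹, psi (2 * m) (d ^ 2 * s + s⁻¹) := by
    have h := S2_eq_sum hm hF (d ^ 2) (b := b) hω
    rw [SubmonoidClass.coe_pow] at h
    rw [h, sum_unit_add_inv hF hk0 (fun x => if b * chi (2 * m) (ω * x) = 1 then
      psi (2 * m) ((d : F) ^ 2 * x) else 0), ← Finset.sum_sub_distrib, Finset.sum_filter]
    simp only [mul_zero, chi_zero hke hk0, zero_ne_one, if_false, zero_add]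
    refine Finset.sum_congr rfl fun s _ => ?_
    have hiff : b * chi (2 * m) (ω * (s : F)) = 1 ↔ chi (2 * m) s = β⁻¹ := by
      rw [chi_mul, ← mul_assoc, ← hβF, chi_coe, ← MulMemClass.coe_mul, OneMemClass.coe_eq_one,
        mul_comm β, mul_eq_one_iff_eq_inv₀ hβ0]
    simp only [hiff]
    split_ifs
    · rw [psi_add hL, ← SubmonoidClass.coe_pow, ← MulMemClass.coe_mul, psi_coe]
      ring
    · ring
  have hd2 : chi (2 * m) (d ^ 2) = 1 := by rw [pow_two, chi_mul, hd, one_mul]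
  have hiff : β⁻¹ = 1 ↔ b * chi (2 * m) ω = 1 := by
    rw [inv_eq_one, ← hβF, OneMemClass.coe_eq_one]
  rw [key, mul_sub, three_mul_sum_psi_mul_chi hL hm rfl (pow_ne_zero 2 he) hβi, hdist _ hβi, hd2,
    mul_one]
  simp only [hiff]

lemma three_mul_sum_sgn_chi {L : Type*} [Field L] [Fintype L] [DecidableEq L] [CharP L 2]
    {m : ℕ} (hL : Fintype.card L = 2 ^ (2 * m)) (hm : Odd m) {b : L} (hb : b ^ 3 = 1) (c : L) :
    3 * ∑ z : L with z ≠ 0,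
        (2 * (if chi (2 * m) z = b then 1 else 0) - 1) * psi (2 * m) (c * z) =
      1 - 2 ^ (m + 1) + (if b * chi (2 * m) c = 1 then 6 * 2 ^ m else 0) +
        (if c = 0 then 2 ^ (m + 1) - 2 ^ (2 * m) else 0) := by
  have hk0 : 2 * m ≠ 0 := by grind
  have hke : Even (2 * m) := even_two_mul m
  have hb0 : b ≠ 0 := fun h => by simp [h] at hb
  have h0 := sum_eq_zero_add_sum_ne_zero
    (fun z : L => (2 * (if chi (2 * m) z = b then (1 : ℤ) else 0) - 1) * psi (2 * m) (c * z))
  have h1 : ∑ z : L, (2 * (if chi (2 * m) z = b then (1 : ℤ) else 0) - 1) * psi (2 * m) (c * z) =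
      2 * ∑ z : L with chi (2 * m) z = b, psi (2 * m) (c * z) -
        ∑ z : L, psi (2 * m) (c * z) := by
    rw [Finset.sum_filter, Finset.mul_sum, ← Finset.sum_sub_distrib]
    refine Finset.sum_congr rfl fun z _ => ?_
    split_ifs <;> ring
  rw [h1, sum_psi_mul hL hk0] at h0
  simp only [chi_zero hke hk0, hb0.symm, if_false, mul_zero, psi_zero, zero_sub, mul_one] at h0
  by_cases hc : c = 0
  · subst hc
    have h2 := card_chi_eq hL hke hk0 hb
    simp only [zero_mul, psi_zero, Finset.sum_const, nsmul_eq_mul, mul_one, if_true,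
      chi_zero hke hk0,
      mul_zero, zero_ne_one, if_false] at h0 h2 ⊢
    linarith
  · have h2 := three_mul_sum_psi_mul_chi hL hm rfl hc hb
    simp only [hc, if_false] at h0 h2 ⊢
    rw [pow_succ] at h2 ⊢
    split_ifs at h2 ⊢ <;> linarith

lemma sgn_fAB {m : ℕ} (hF : Fintype.card F = 2 ^ (2 * m + 2 * m)) (hm0 : m ≠ 0)
    (e : gfField F (2 * m)) {b ω u z : F} (hb : b ^ 3 = 1) (hω : ω ^ 2 ^ (2 * m) = ω)
    (hu : u ^ (2 ^ (2 * m) + 1) = 1) (hz0 : z ≠ 0) (hz : z ^ 2 ^ (2 * m) = z) :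
    sgn (fAB (2 * m + 2 * m) (2 * m) ((e : F) ^ 2) b (u * z) +
        absTr (2 * m + 2 * m) (ω * (u * z))) =
      psi (2 * m) ((e : F) * (u + u⁻¹)) *
        ((2 * (if chi (2 * m) z = b then 1 else 0) - 1) *
          psi (2 * m) (ω * (u + u⁻¹) * z)) := by
  have hk0 : 2 * m ≠ 0 := by omega
  have hke : Even (2 * m) := even_two_mul m
  have hz3 := chi_pow_three_of_pow_eq hke hz0 hz
  have hiff : b * chi (2 * m) z ^ 2 = 1 ↔ chi (2 * m) z = b := by
    constructor
    · intro h
      linear_combination b * hz3 - chi (2 * m) z * h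
    · intro h
      rw [h, ← pow_succ', hb]
  have hr : (b * chi (2 * m) z ^ 2) ^ 3 = 1 := by
    rw [mul_pow, hb, pow_right_comm, hz3, one_pow, one_mul]
  have hA : fA (2 * m + 2 * m) (2 * m) ((e : F) ^ 2) (u * z) ^ 2 =
      fA (2 * m + 2 * m) (2 * m) ((e : F) ^ 2) (u * z) := absTr_pow_two hF _
  rw [fAB, gB, chi_unit_mul hke hu hz, sgn_add _ (absTr_pow_two hF _), sgn_add hA (tr2_sq hr),
    sgn_fA hF hk0 e hu hz0 hz, sgn_tr2 hr, mul_assoc]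
  · simp only [hiff]
    congr 2
    exact psi_unit_mul hu hz hω
  · rw [CharTwo.add_sq, hA, tr2_sq hr]

lemma three_mul_walsh {m : ℕ} (hm : Odd m) (hF : Fintype.card F = 2 ^ (2 * m + 2 * m))
    {e : gfField F (2 * m)} (he : e ≠ 0) {b ω : F} (hb : b ^ 3 = 1) (hω : ω ^ 2 ^ (2 * m) = ω)
    (hω0 : ω ≠ 0) :
    3 * walsh (2 * m + 2 * m) (fAB (2 * m + 2 * m) (2 * m) ((e : F) ^ 2) b) ω =
      3 + (1 - kloo (2 * m) (e : F)) * (1 - 2 ^ (m + 1)) +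
        6 * 2 ^ m * S2 (2 * m + 2 * m) (2 * m) m ((e : F) ^ 2) b ω + 2 ^ (m + 1) -
        2 ^ (2 * m) := by
  have hm0 : m ≠ 0 := by grind
  have hk0 : 2 * m ≠ 0 := by omega
  have hke : Even (2 * m) := even_two_mul m
  have hL := card_gfField hF hk0
  have hbK := pow_two_pow_of_cube_eq_one hke hb
  have h0 : sgn (fAB (2 * m + 2 * m) (2 * m) ((e : F) ^ 2) b 0 +
      absTr (2 * m + 2 * m) (ω * 0)) = 1 := by
    have h1 : 2 ^ (2 * m) - 1 ≠ 0 := by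
      have := Nat.one_lt_two_pow hk0
      omega
    have h2 : chi (2 * m + 2 * m) (0 : F) = 0 := chi_zero (hke.add hke) (by omega)
    simp [fAB, fA, gB, tr2, h1, h2, sgn]
  have hinner : ∀ u : F, u ^ (2 ^ (2 * m) + 1) = 1 →
      3 * ∑ z : gfField F (2 * m) with z ≠ 0,
        sgn (fAB (2 * m + 2 * m) (2 * m) ((e : F) ^ 2) b (u * z) +
          absTr (2 * m + 2 * m) (ω * (u * z))) =
      psi (2 * m) ((e : F) * (u + u⁻¹)) * (1 - 2 ^ (m + 1)) +
        6 * 2 ^ m * (if b * chi (2 * m) (ω * (u + u⁻¹)) = 1 then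
          psi (2 * m) ((e : F) * (u + u⁻¹)) else 0) +
        (if u = 1 then 2 ^ (m + 1) - 2 ^ (2 * m) else 0) := by
    intro u hu
    obtain ⟨c, hc⟩ : ∃ c : gfField F (2 * m), (c : F) = ω * (u + u⁻¹) :=
      ⟨⟨_, mul_mem (mem_gfField.2 hω) (unit_add_inv_mem hu)⟩, rfl⟩
    have hsum := three_mul_sum_sgn_chi hL hm (b := ⟨b, hbK⟩) (Subtype.ext (by simpa using hb)) c
    have hterm : ∑ z : gfField F (2 * m) with z ≠ 0,
        sgn (fAB (2 * m + 2 * m) (2 * m) ((e : F) ^ 2) b (u * z) +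
          absTr (2 * m + 2 * m) (ω * (u * z))) =
        psi (2 * m) ((e : F) * (u + u⁻¹)) * ∑ z : gfField F (2 * m) with z ≠ 0,
          (2 * (if chi (2 * m) z = ⟨b, hbK⟩ then 1 else 0) - 1) * psi (2 * m) (c * z) := by
      rw [Finset.mul_sum]
      refine Finset.sum_congr rfl fun z hz => ?_
      have hz0 : (z : F) ≠ 0 := by simpa using hz
      rw [sgn_fAB hF hm0 e hb hω hu hz0 z.2, ← hc, ← MulMemClass.coe_mul, psi_coe, chi_coe]
      simp only [Subtype.ext_iff]
    have hiff₁ : (⟨b, hbK⟩ : gfField F (2 * m)) * chi (2 * m) c = 1 ↔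
        b * chi (2 * m) (ω * (u + u⁻¹)) = 1 := by
      rw [← hc, chi_coe, ← OneMemClass.coe_eq_one, MulMemClass.coe_mul]
    have hiff₂ : c = 0 ↔ u = 1 := by
      rw [← ZeroMemClass.coe_eq_zero, hc]
      constructor
      · intro h
        refine eq_one_of_unit_of_mem hu ?_
        rw [mem_gfField, ← inv_eq_of_unit hu]
        exact (CharTwo.add_eq_zero.1 ((mul_eq_zero.1 h).resolve_left hω0)).symm
      · rintro rfl
        rw [inv_one, CharTwo.add_self_eq_zero, mul_zero]
    rw [hterm, mul_left_comm, hsum]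
    simp only [hiff₁, hiff₂]
    by_cases h1 : u = 1
    · subst h1
      simp only [inv_one, CharTwo.add_self_eq_zero, mul_zero, psi_zero]
      split_ifs <;> ring
    · simp only [h1, if_false]
      split_ifs <;> ring
  rw [walsh, sum_eq_zero_add_sum_ne_zero, h0, sum_polar hF, mul_add, Finset.mul_sum,
    Finset.sum_congr rfl fun u hu => hinner u (by simpa using hu), Finset.sum_add_distrib,
    Finset.sum_add_distrib, ← Finset.sum_mul, ← Finset.mul_sum, sum_unit_psi hF hk0 he,
    ← S2_eq_sum hm hF e hω]
  simp
  ring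

end WalshTransform

/-- For `ν = 2` (so `n = 4·m₂` with `m₂` odd, `m₁ = 2·m₂`), `a ∈ F_{2^{m₁}}^*` with
`K_{m₁}(a) ≡ 1 (mod 3)`, `b ∈ F_4^*` and `ω ∈ F_{2^{m₁}}^*` with polar decomposition
`ω = w₂·y` in `F_{2^{m₁}}^*`, setting `γ = b·χ_{m₁}(w₂)` and letting `t ∈ {0,1}`
represent `tr_2(γ) ∈ F_2`:
`3·S_2(a,b,ω) = 2^{m₂+1} − K_{m₁}(a) − 3·t·2^{m₂}` and
`3·(W_{f_{a,b}}(ω) − (−1)^t·2^{m₁}) = 4 − K_{m₁}(a)`. -/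
theorem S2_and_walsh_subfield_case_K1mod3
    {F : Type*} [Field F] [Fintype F]
    (n m1 m2 : ℕ) (hm2 : Odd m2) (hm1 : m1 = 2 * m2) (hn : n = 4 * m2)
    (hF : Fintype.card F = 2 ^ n)
    (a b : F) (ha : a ^ 2 ^ m1 = a) (ha0 : a ≠ 0)
    (hK : kloo m1 a ≡ 1 [ZMOD 3])
    (hb : b ^ 3 = 1) (hb0 : b ≠ 0)
    (ω w2 y : F) (hω : ω ^ 2 ^ m1 = ω) (hω0 : ω ≠ 0)
    (hw2 : w2 ^ (2 ^ m2 + 1) = 1) (hy : y ^ 2 ^ m2 = y) (hy0 : y ≠ 0)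
    (hdec : ω = w2 * y)
    (γ : F) (hγ : γ = b * chi m1 w2)
    (t : ℕ) (ht : t = 0 ∨ t = 1) (htr : tr2 γ = (t : F)) :
    3 * S2 n m1 m2 a b ω = 2 ^ (m2 + 1) - kloo m1 a - 3 * (t : ℤ) * 2 ^ m2 ∧
    3 * (walsh n (fAB n m1 a b) ω - (-1) ^ t * 2 ^ m1) = 4 - kloo m1 a := by
  subst hm1
  obtain rfl : n = 2 * m2 + 2 * m2 := by omega
  have : CharP F 2 := charP_of_card_eq_prime_pow hF
  have hm0 : m2 ≠ 0 := by grind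
  have hk0 : 2 * m2 ≠ 0 := by omega
  obtain ⟨e, he⟩ := sq_bijective.2 (⟨a, ha⟩ : gfField F (2 * m2))
  obtain rfl : (e : F) ^ 2 = a := congrArg Subtype.val he
  have he0 : e ≠ 0 := by
    rintro rfl
    simp at ha0
  rw [kloo_sq hF hk0] at hK ⊢
  have hchi : chi (2 * m2) ω = chi (2 * m2) w2 := by
    rw [hdec, chi_mul, chi_eq_one_of_odd hm2 hy hy0, mul_one]
  have hS := three_mul_S2 hm2 hF he0 hK hb hω hω0
  have hW := three_mul_walsh hm2 hF he0 hb hω hω0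
  rw [hchi, ← hγ] at hS
  have hγt : γ = 1 ↔ t = 0 := by
    have hγ3 : γ ^ 3 = 1 := by
      rw [hγ, mul_pow, hb, chi_pow_three_of_pow_eq (even_two_mul m2) (ne_zero_of_unit hw2)
        (unit_pow_two_mul hw2), one_mul]
    have hsgn := sgn_tr2 hγ3
    rw [htr] at hsgn
    rcases ht with rfl | rfl
    · rw [Nat.cast_zero, sgn, if_pos rfl] at hsgn
      split_ifs at hsgn with h
      · exact iff_of_true h rfl
      · omega
    · rw [Nat.cast_one, sgn, if_neg one_ne_zero] at hsgn
      split_ifs at hsgn with h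
      · omega
      · exact iff_of_false h one_ne_zero
  have hpow : (2 : ℤ) ^ (m2 + 1) = 2 * 2 ^ m2 := pow_succ' 2 m2
  have hsq : (2 : ℤ) ^ (2 * m2) = (2 ^ m2) ^ 2 := by rw [mul_comm, pow_mul]
  rw [hpow] at hS hW ⊢
  rw [hsq] at hW ⊢
  rcases ht with rfl | rfl
  · rw [if_pos (hγt.2 rfl)] at hS
    refine ⟨by linear_combination hS, ?_⟩
    linear_combination hW + 2 * 2 ^ m2 * hS
  · rw [if_neg (fun h => by simpa using hγt.1 h)] at hS
    refine ⟨by push_cast; linear_combination hS, ?_⟩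
    linear_combination hW + 2 * 2 ^ m2 * hS
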